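/- arXiv:1702.06448 — 2 statements merged into one kernel-verified Lean document; each statement's English description precedes it below -/
import Mathlib

section
/- Let v be a reduced word over the generators V(T) ∪ {a} ∪ B of K which is Dehn-minimal with respect to the given presentation of K. Then the element of K represented by v lies in the subgroup of K generated by B if and only if v contains only letters from B and their inverses. -/
/-- Generators of the group `K`: tree vertices `(n,τ)`, the letter `a`, and letters `bᵢ`. -/
inductive KGen : Type
  | vert : ℕ → List ℤ → KGen
  | a : KGen
  | b : ℤ → KGen
  deriving DecidableEq

/-- The parent `(n,τ)⁻` of a vertex `(n,τ)` of the tree `T`. -/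
def parent : ℕ → List ℤ → ℕ × List ℤ
  | n, [] => (n + 1, [])
  | n, τ => (n, τ.dropLast)

/-- Words over an alphabet `α` (a letter together with `true` for the letter itself,
`false` for its formal inverse). -/
abbrev Word (α : Type) := List (α × Bool)

/-- The word `u(x,y) = x y x² y x³ y ⋯ x¹⁰⁰ y`. -/
def uWord {α : Type} (x y : α) : Word α :=
  (List.range 100).flatMap fun k => List.replicate (k + 1) (x, true) ++ [(y, true)]

/-- The relator words of the presentation of `K`:
`u((n,τ),a) ((n,τ)⁻)⁻¹` and `u((n,τ),bᵢ) ((n,τ⌢⟨i⟩))⁻¹`. -/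
def KRelWords : Set (Word KGen) :=
  { w | (∃ (n : ℕ) (τ : List ℤ), w = uWord (KGen.vert n τ) KGen.a ++ [(KGen.vert (parent n τ).1 (parent n τ).2, false)]) ∨
        (∃ (n : ℕ) (τ : List ℤ) (i : ℤ), w = uWord (KGen.vert n τ) (KGen.b i) ++ [(KGen.vert n (τ ++ [i]), false)]) }

/-- The relators of `K` as elements of the free group. -/
def KRels : Set (FreeGroup KGen) := FreeGroup.mk '' KRelWords

/-- The group `K`. -/
abbrev K := PresentedGroup KRels



/-- A word is reduced if it contains no adjacent cancelling pair. -/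
def IsReducedWord {α : Type} [DecidableEq α] (w : Word α) : Prop := FreeGroup.reduce w = w

/-- The formal inverse of a word. -/
def wordInv {α : Type} (w : Word α) : Word α := (w.map fun p => (p.1, !p.2)).reverse

/-- `w` is a cyclic permutation of `v`. -/
def IsCyclicPermOf {α : Type} (w v : Word α) : Prop := ∃ x y, v = x ++ y ∧ w = y ++ x

/-- A word is cyclically reduced if it is reduced even when read cyclically. -/
def IsCyclicallyReduced {α : Type} [DecidableEq α] (w : Word α) : Prop := IsReducedWord (w ++ w)

/-- `r'` is the cyclic reduction of `r`: `r'` is cyclically reduced and the reduced form of `r`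
is `c⁻¹ r' c` for some word `c`. -/
def IsCyclicReductionOf {α : Type} [DecidableEq α] (r' r : Word α) : Prop :=
  IsCyclicallyReduced r' ∧ ∃ c : Word α, FreeGroup.reduce r = wordInv c ++ r' ++ c

/-- The symmetrized closure of a set of relators: all cyclic permutations of the cyclic
reductions of the relators and of their inverses. -/
def symmClosure {α : Type} [DecidableEq α] (R : Set (Word α)) : Set (Word α) :=
  { w | ∃ r ∈ R, ∃ r', IsCyclicReductionOf r' r ∧
      (IsCyclicPermOf w r' ∨ IsCyclicPermOf w (wordInv r')) }

/-- A word `w` is Dehn-minimal w.r.t. relators `R` if it contains no subword `v` which is also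
a subword of some `r` in the symmetrized closure of `R` with `|v| > |r|/2`. -/
def DehnMinimal {α : Type} [DecidableEq α] (R : Set (Word α)) (w : Word α) : Prop :=
  ∀ v r : Word α, r ∈ symmClosure R → v <:+: w → v <:+: r → 2 * v.length ≤ r.length

/-- A piece: a reduced word which is a common initial segment of two distinct elements of the
symmetrized closure of the relator set. -/
def IsPiece {α : Type} [DecidableEq α] (R : Set (Word α)) (p : Word α) : Prop :=
  IsReducedWord p ∧ ∃ r₁ ∈ symmClosure R, ∃ r₂ ∈ symmClosure R, r₁ ≠ r₂ ∧ p <+: r₁ ∧ p <+: r₂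

namespace SmallCancellation

open FreeGroup

section Words

variable {α β : Type}

theorem isReduced_append_iff {L₁ L₂ : Word α} :
    IsReduced (L₁ ++ L₂) ↔ IsReduced L₁ ∧ IsReduced L₂ ∧
      ∀ p ∈ L₁.getLast?, ∀ q ∈ L₂.head?, p.1 = q.1 → p.2 = q.2 :=
  List.isChain_append

theorem isReduced_append_of_disjoint {L₁ L₂ : Word α} (h₁ : IsReduced L₁) (h₂ : IsReduced L₂)
    (h : ∀ p ∈ L₁.getLast?, ∀ q ∈ L₂, p.1 ≠ q.1) : IsReduced (L₁ ++ L₂) :=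
  isReduced_append_iff.2 ⟨h₁, h₂, fun p hp q hq e => absurd e (h p hp q (List.mem_of_mem_head? hq))⟩

theorem _root_.FreeGroup.IsReduced.of_isInfix {L L' : Word α} (h : IsReduced L) (hL : L' <:+: L) :
    IsReduced L' := h.infix hL

theorem isReduced_invRev {L : Word α} (h : IsReduced L) : IsReduced (invRev L) := by
  unfold FreeGroup.IsReduced at *
  rw [invRev, List.isChain_reverse, List.isChain_map]
  refine h.imp fun p q hpq e => ?_
  simp only at e ⊢
  rw [hpq e.symm]

theorem isReduced_of_sign {L : Word α} {e : Bool} (h : ∀ p ∈ L, p.2 = e) : IsReduced L := by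
  unfold FreeGroup.IsReduced
  rw [List.isChain_iff_forall_rel_of_append_cons_cons]
  rintro p q l₁ l₂ rfl -
  rw [h p (by simp), h q (by simp)]

theorem eq_nil_of_mk_eq_one {L : Word α} (h : IsReduced L) (h1 : FreeGroup.mk L = 1) : L = [] := by
  classical
  rw [← h.reduce_eq, ← FreeGroup.toWord_mk, h1, FreeGroup.toWord_one]

theorem mk_append (L L' : Word α) :
    FreeGroup.mk (L ++ L') = FreeGroup.mk L * FreeGroup.mk L' := FreeGroup.mul_mk.symm

theorem mk_invRev (L : Word α) :
    FreeGroup.mk (invRev L) = (FreeGroup.mk L)⁻¹ := FreeGroup.inv_mk.symm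

theorem mem_invRev {L : Word α} {p : α × Bool} : p ∈ invRev L ↔ (p.1, !p.2) ∈ L := by
  simp only [invRev, List.mem_reverse, List.mem_map, Prod.exists]
  constructor
  · rintro ⟨a, b, h, rfl⟩
    simpa using h
  · intro h
    exact ⟨p.1, !p.2, h, by simp⟩

theorem invRev_isInfix {v w : Word α} (h : v <:+: w) : invRev v <:+: invRev w := by
  obtain ⟨s, t, rfl⟩ := h
  exact ⟨invRev t, invRev s, by simp [FreeGroup.invRev_append]⟩

theorem eq_nil_of_isReduced_invRev_append {b : Word α} (h : IsReduced (invRev b ++ b)) : b = [] := by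
  have := eq_nil_of_mk_eq_one h (by rw [mk_append, mk_invRev, inv_mul_cancel])
  exact (List.append_eq_nil_iff.1 this).2

/-- The product of two reduced words is computed by cancelling a suffix of the first factor against
a prefix of the second one. -/
theorem exists_cancellation {r s : Word α} (hr : IsReduced r) (hs : IsReduced s) :
    ∃ r' c s', r = r' ++ c ∧ s = invRev c ++ s' ∧ IsReduced (r' ++ s') := by
  induction r using List.reverseRecOn generalizing s with
  | nil => exact ⟨[], [], s, rfl, rfl, hs⟩
  | append_singleton r p ih =>
    by_cases hj : ∀ q ∈ s.head?, p.1 = q.1 → p.2 = q.2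
    · refine ⟨r ++ [p], [], s, by simp, rfl, isReduced_append_iff.2 ⟨hr, hs, ?_⟩⟩
      simpa using hj
    · push Not at hj
      obtain ⟨q, hq, e, hne⟩ := hj
      obtain ⟨s₁, rfl⟩ : ∃ s₁, s = q :: s₁ := by
        cases s with
        | nil => simp at hq
        | cons x s => exact ⟨s, by simp at hq; rw [hq]⟩
      obtain ⟨r', c, s', rfl, rfl, hred⟩ := ih (s := s₁) (hr.of_isInfix ⟨[], [p], by simp⟩)
        (hs.of_isInfix ⟨[q], [], by simp⟩)
      refine ⟨r', c ++ [p], s', by simp, ?_, hred⟩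
      have : q = (p.1, !p.2) := by
        ext
        · exact e.symm
        · rw [Bool.eq_not_of_ne hne]; simp
      simp [this, FreeGroup.invRev]

theorem infix_append_of_count_lt {A M C v : List β} (p : β → Bool) (h : v <:+: A ++ M ++ C)
    (hc : v.countP p < M.countP p) : v <:+: A ++ M ∨ v <:+: M ++ C := by
  rw [List.append_assoc, List.infix_append_iff] at h
  rcases h with h | h | ⟨l, r, rfl, ⟨s, rfl⟩, h⟩
  · exact .inl (h.trans ⟨[], M, by simp⟩)
  · exact .inr h
  · obtain ⟨t, h⟩ := h
    rcases List.append_eq_append_iff.1 h with ⟨u, rfl, rfl⟩ | ⟨u, rfl, rfl⟩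
    · exact .inl ⟨s, u, by simp⟩
    · simp only [List.countP_append] at hc
      omega

/-- Splitting an infix of a concatenation. -/
theorem exists_of_infix_append {A C v : List β} (h : v <:+: A ++ C) :
    ∃ v₁ v₂, v = v₁ ++ v₂ ∧ v₁ <:+: A ∧ v₂ <:+: C := by
  rcases List.infix_append_iff.1 h with h | h | ⟨l, r, rfl, h₁, h₂⟩
  · exact ⟨v, [], by simp, h, List.nil_infix⟩
  · exact ⟨[], v, by simp, List.nil_infix, h⟩
  · exact ⟨l, r, rfl, h₁.isInfix, h₂.isInfix⟩

end Words

end SmallCancellation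

namespace SmallCancellation

open FreeGroup

/-- The positions of the letter `y` in `u(x,y)`. -/
def IsMark (n : ℕ) : Prop := ∃ k : ℕ, 2 * (n + 1) = k * (k + 3)

theorem not_isMark_succ {n : ℕ} (h : IsMark n) : ¬ IsMark (n + 1) := by
  rintro ⟨l, hl⟩
  obtain ⟨k, hk⟩ := h
  have h1 : k < l := by
    by_contra hlt
    have : l * (l + 3) ≤ k * (k + 3) := Nat.mul_le_mul (by omega) (by omega)
    omega
  have : (k + 1) * (k + 1 + 3) ≤ l * (l + 3) := Nat.mul_le_mul (by omega) (by omega)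
  have hk0 : k ≠ 0 := by rintro rfl; omega
  have : 1 ≤ k := by omega
  nlinarith

theorem exists_least_mark (i : ℕ) (hi : i < 5150) :
    ∃ k : ℕ, k ≤ 100 ∧ 2 * (i + 1) ≤ k * (k + 3) ∧ k * (k + 3) ≤ 2 * (i + k + 1) ∧ 1 ≤ k := by
  have hex : ∃ k : ℕ, 2 * (i + 1) ≤ k * (k + 3) := ⟨100, by omega⟩
  classical
  obtain ⟨k, hk, hmin⟩ : ∃ k : ℕ, 2 * (i + 1) ≤ k * (k + 3) ∧ ∀ m < k, ¬ 2 * (i + 1) ≤ m * (m + 3) :=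
    ⟨Nat.find hex, Nat.find_spec hex, fun m hm => Nat.find_min hex hm⟩
  have hk1 : 1 ≤ k := by
    by_contra h
    obtain rfl : k = 0 := by omega
    omega
  obtain ⟨m, rfl⟩ : ∃ m, k = m + 1 := ⟨k - 1, by omega⟩
  have := hmin m (by omega)
  have hs : (m + 1) * (m + 1 + 3) = m * (m + 1) + 4 * m + 4 := by ring
  have hs' : m * (m + 3) = m * (m + 1) + 2 * m := by ring
  obtain ⟨c, hc⟩ := (Nat.even_mul_succ_self m).two_dvd
  refine ⟨m + 1, ?_, hk, by omega, by omega⟩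
  by_contra h
  exact hmin 100 (by omega) (by omega)

/-- Every window of length `101` contains a mark. -/
theorem exists_isMark_window (i : ℕ) (hi : i + 101 ≤ 5150) : ∃ s < 101, IsMark (i + s) := by
  obtain ⟨k, hk, h1, h2, -⟩ := exists_least_mark i (by omega)
  have hpar : 2 ∣ k * (k + 3) := by
    have : k * (k + 3) = k * (k + 1) + 2 * k := by ring
    rw [this]
    exact dvd_add (Nat.even_mul_succ_self k).two_dvd ⟨k, rfl⟩
  obtain ⟨c, hc⟩ := hpar
  exact ⟨c - 1 - i, by omega, k, by omega⟩

/-- A long window determines its position. -/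
theorem eq_of_isMark_window {i j : ℕ} (hi : i + 203 ≤ 5150)
    (h : ∀ s < 203, IsMark (i + s) ↔ IsMark (j + s)) : i = j := by
  obtain ⟨k, hk, h1, h2, hk1⟩ := exists_least_mark i (by omega)
  have hpar : 2 ∣ k * (k + 3) := by
    have : k * (k + 3) = k * (k + 1) + 2 * k := by ring
    rw [this]
    exact dvd_add (Nat.even_mul_succ_self k).two_dvd ⟨k, rfl⟩
  obtain ⟨c, hc⟩ := hpar
  have hs : (k + 1) * (k + 1 + 3) = k * (k + 3) + 2 * k + 4 := by ring
  obtain ⟨l, hl⟩ := (h (c - 1 - i) (by omega)).1 ⟨k, by omega⟩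
  obtain ⟨m, hm⟩ := (h (c - 1 - i + k + 2) (by omega)).1 ⟨k + 1, by omega⟩
  have hlm : l < m := by
    by_contra hlt
    have : m * (m + 3) ≤ l * (l + 3) := Nat.mul_le_mul (by omega) (by omega)
    omega
  have hs' : (l + 1) * (l + 1 + 3) = l * (l + 3) + 2 * l + 4 := by ring
  have hm' : (l + 1) * (l + 1 + 3) ≤ m * (m + 3) := Nat.mul_le_mul (by omega) (by omega)
  have hlk : l ≤ k := by omega
  -- if `l < k` then the mark after the first one comes too early in the second window
  rcases hlk.lt_or_eq with hlt | rfl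
  · exfalso
    obtain ⟨m', hm2⟩ := (h (c - 1 - i + l + 2) (by omega)).2 ⟨l + 1, by omega⟩
    have hkm : k < m' := by
      by_contra hlt
      have : m' * (m' + 3) ≤ k * (k + 3) := Nat.mul_le_mul (by omega) (by omega)
      omega
    have : (k + 1) * (k + 1 + 3) ≤ m' * (m' + 3) := Nat.mul_le_mul (by omega) (by omega)
    omega
  · omega

section

variable {α : Type} (x y : α)

theorem length_uPartial (N : ℕ) : 2 * ((List.range N).flatMap fun k =>
    List.replicate (k + 1) (x, true) ++ [(y, true)]).length = N * (N + 3) := by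
  induction N with
  | zero => simp
  | succ N ih =>
    rw [List.range_succ, List.flatMap_append, List.length_append, mul_add, ih]
    simp
    ring

theorem length_uWord : (uWord x y).length = 5150 := by
  have := length_uPartial x y 100
  unfold uWord
  omega

theorem getElem?_uPartial (N n : ℕ) (hn : 2 * n < N * (N + 3)) :
    ((List.range N).flatMap fun k => List.replicate (k + 1) (x, true) ++ [(y, true)])[n]? =
      some (open Classical in if IsMark n then y else x, true) := by
  induction N with
  | zero => simp at hn
  | succ N ih =>
    rw [List.range_succ, List.flatMap_append]
    have hl := length_uPartial x y N
    have hs : (N + 1) * (N + 1 + 3) = N * (N + 3) + 2 * N + 4 := by ring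
    by_cases h : 2 * n < N * (N + 3)
    · rw [List.getElem?_append_left (by omega), ih h]
    · rw [List.getElem?_append_right (by omega)]
      set m := n - ((List.range N).flatMap fun k =>
        List.replicate (k + 1) (x, true) ++ [(y, true)]).length with hm
      have hm1 : m ≤ N + 1 := by omega
      simp only [List.flatMap_cons, List.flatMap_nil, List.append_nil]
      rcases hm1.lt_or_eq with hlt | heq
      · rw [List.getElem?_append_left (by simpa using hlt), List.getElem?_replicate, if_pos hlt,
          if_neg]
        rintro ⟨k, hk⟩
        have h1 : N < k := by
          by_contra hlt
          have : k * (k + 3) ≤ N * (N + 3) := Nat.mul_le_mul (by omega) (by omega)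
          omega
        have : (N + 1) * (N + 1 + 3) ≤ k * (k + 3) := Nat.mul_le_mul (by omega) (by omega)
        omega
      · rw [List.getElem?_append_right (by simp [heq]), if_pos ⟨N + 1, by omega⟩]
        simp [heq]

theorem getElem?_uWord (n : ℕ) (hn : n < 5150) :
    (uWord x y)[n]? = some (open Classical in if IsMark n then y else x, true) :=
  getElem?_uPartial x y 100 n (by omega)

variable {x y}

theorem getElem?_infix_uWord {s v t : Word α} (h : s ++ v ++ t = uWord x y) {n : ℕ}
    (hn : n < v.length) :
    v[n]? = some (open Classical in if IsMark (s.length + n) then y else x, true) := by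
  have hl := congrArg List.length h
  rw [length_uWord] at hl
  simp only [List.length_append] at hl
  rw [← getElem?_uWord x y _ (by omega), ← h, List.append_assoc, List.getElem?_append_right (by simp),
    List.getElem?_append_left (by omega)]
  simp

theorem mem_uWord {p : α × Bool} (h : p ∈ uWord x y) : (p.1 = x ∨ p.1 = y) ∧ p.2 = true := by
  simp only [uWord, List.mem_flatMap, List.mem_append, List.mem_replicate, List.mem_singleton] at h
  obtain ⟨k, -, ⟨-, rfl⟩ | rfl⟩ := h <;> simp

theorem isReduced_uWord : IsReduced (uWord x y) :=
  isReduced_of_sign fun _ hp => (mem_uWord hp).2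

theorem eq_offset_of_infix_uWord (hxy : x ≠ y) {s s' v t t' : Word α} (h : s ++ v ++ t = uWord x y)
    (h' : s' ++ v ++ t' = uWord x y) (hv : 203 ≤ v.length) : s.length = s'.length := by
  have hl := congrArg List.length h
  rw [length_uWord] at hl
  simp only [List.length_append] at hl
  refine eq_of_isMark_window (by omega) fun n hn => ?_
  have h1 := getElem?_infix_uWord h (n := n) (by omega)
  rw [getElem?_infix_uWord h' (n := n) (by omega)] at h1
  simp only [Option.some.injEq, Prod.mk.injEq, and_true] at h1
  split_ifs at h1 with h2 h3 h3 <;> simp_all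

theorem length_le_of_infix_uWord {v : Word α} (h : v <:+: uWord x y) (hv : ∀ p ∈ v, p.1 ≠ y) :
    v.length ≤ 100 := by
  obtain ⟨s, t, h⟩ := h
  by_contra hlt
  have hl := congrArg List.length h
  rw [length_uWord] at hl
  simp only [List.length_append] at hl
  obtain ⟨n, hn, hm⟩ := exists_isMark_window s.length (by omega)
  have h1 := getElem?_infix_uWord h (n := n) (by omega)
  rw [if_pos hm] at h1
  exact hv _ (List.mem_of_getElem? h1) rfl

variable [DecidableEq α]

/-- The number of letters of a word different from `y` and `y⁻¹`. -/
def cnt (y : α) (v : Word α) : ℕ := v.countP fun p => p.1 ≠ y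

/-- The number of letters `y` and `y⁻¹` of a word. -/
def occ (y : α) (v : Word α) : ℕ := v.countP fun p => p.1 = y

theorem cnt_append (y : α) (v w : Word α) : cnt y (v ++ w) = cnt y v + cnt y w :=
  List.countP_append

theorem occ_append (y : α) (v w : Word α) : occ y (v ++ w) = occ y v + occ y w :=
  List.countP_append

theorem cnt_add_occ (y : α) (v : Word α) : cnt y v + occ y v = v.length := by
  rw [cnt, occ, List.length_eq_countP_add_countP (fun p : α × Bool => p.1 = y), add_comm]
  simp

theorem occ_le_of_isInfix {y : α} {v w : Word α} (h : v <:+: w) : occ y v ≤ occ y w :=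
  h.sublist.countP_le

theorem occ_invRev (y : α) (v : Word α) : occ y (invRev v) = occ y v := by
  simp [occ, invRev, List.countP_map, Function.comp_def]

theorem occ_eq_zero {y : α} {v : Word α} (h : ∀ p ∈ v, p.1 ≠ y) : occ y v = 0 := by
  simpa [occ, List.countP_eq_zero] using h

theorem cnt_eq_zero {y : α} {v : Word α} (h : ∀ p ∈ v, p.1 = y) : cnt y v = 0 := by
  simpa [cnt, List.countP_eq_zero] using h

theorem occ_uWord_right (hxy : x ≠ y) : occ y (uWord x y) = 100 := by
  simp [occ, uWord, List.countP_flatMap, List.countP_replicate, hxy, Function.comp_def]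

theorem two_le_occ_of_infix_uWord {v : Word α} (h : v <:+: uWord x y) (hv : 4 ≤ v.length) :
    2 ≤ occ x v := by
  obtain ⟨s, t, h⟩ := h
  have key : ∀ n, n + 1 < v.length → ∃ m, n ≤ m ∧ m ≤ n + 1 ∧ v[m]? = some (x, true) := by
    intro n hn
    by_cases hm : IsMark (s.length + n)
    · refine ⟨n + 1, by omega, by omega, ?_⟩
      rw [getElem?_infix_uWord h (by omega), if_neg]
      exact not_isMark_succ hm
    · exact ⟨n, by omega, by omega, by rw [getElem?_infix_uWord h (by omega), if_neg hm]⟩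
  obtain ⟨m, -, hm, h1⟩ := key 0 (by omega)
  obtain ⟨m', hm', hm2, h2⟩ := key 2 (by omega)
  have e : v = v.take 2 ++ v.drop 2 := by simp
  rw [e, occ_append]
  have a1 : 1 ≤ occ x (v.take 2) := by
    refine List.one_le_countP_iff.2 ⟨(x, true), List.mem_of_getElem? (i := m) ?_, by simp⟩
    rw [List.getElem?_take_of_lt (by omega), h1]
  have a2 : 1 ≤ occ x (v.drop 2) := by
    refine List.one_le_countP_iff.2 ⟨(x, true), List.mem_of_getElem? (i := m' - 2) ?_, by simp⟩
    rw [List.getElem?_drop, show 2 + (m' - 2) = m' by omega, h2]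
  omega

end

end SmallCancellation

namespace SmallCancellation

open FreeGroup

section Arcs

variable {α β : Type}

/-- The word `u(x,y) z⁻¹ u(x,y)`; it contains a copy of every arc of length at most `|u|` of the
cyclic word `u(x,y) z⁻¹`. -/
def arc (x y z : α) : Word α := uWord x y ++ (z, false) :: uWord x y

/-- The word `v` or its inverse is read along the cyclic word `u(x,y) z⁻¹`. -/
def OnArc (x y z : α) (v : Word α) : Prop := v <:+: arc x y z ∨ invRev v <:+: arc x y z

theorem OnArc.of_isInfix {x y z : α} {v w : Word α} (h : OnArc x y z w) (hv : v <:+: w) :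
    OnArc x y z v :=
  h.imp hv.trans (invRev_isInfix hv).trans

theorem map_uWord (f : α → β) (x y : α) :
    (uWord x y).map (fun p => (f p.1, p.2)) = uWord (f x) (f y) := by
  simp [uWord, List.map_flatMap]

theorem map_invRev (f : α → β) (w : Word α) :
    (invRev w).map (fun p => (f p.1, p.2)) = invRev (w.map fun p => (f p.1, p.2)) := by
  simp [invRev, Function.comp_def]

theorem OnArc.map (f : α → β) {x y z : α} {v : Word α} (h : OnArc x y z v) :
    OnArc (f x) (f y) (f z) (v.map fun p => (f p.1, p.2)) := by
  have e : (arc x y z).map (fun p => (f p.1, p.2)) = arc (f x) (f y) (f z) := by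
    simp [arc, map_uWord]
  rw [OnArc, ← map_invRev, ← e]
  exact h.imp (fun h => h.map _) (fun h => h.map _)

theorem OnArc.mem {x y z : α} {v : Word α} (h : OnArc x y z v) {p : α × Bool} (hp : p ∈ v) :
    p.1 = x ∨ p.1 = y ∨ p.1 = z := by
  have key : ∀ q ∈ arc x y z, q.1 = x ∨ q.1 = y ∨ q.1 = z := by
    intro q hq
    rw [arc, List.mem_append, List.mem_cons] at hq
    rcases hq with h | rfl | h
    · exact (mem_uWord h).1.imp_right .inl
    · simp
    · exact (mem_uWord h).1.imp_right .inl
  rcases h with h | h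
  · exact key p (h.subset hp)
  · exact key (p.1, !p.2) (h.subset (mem_invRev.2 (by simpa using hp)))

/-- The word `u(x,y)` or its inverse, according to the sign. -/
def spell (x y : α) (e : Bool) : Word α := if e then uWord x y else invRev (uWord x y)

theorem invRev_spell (x y : α) (e : Bool) : invRev (spell x y e) = spell x y (!e) := by
  cases e <;> simp [spell]

theorem length_spell (x y : α) (e : Bool) : (spell x y e).length = 5150 := by
  cases e <;> simp [spell, length_uWord]

theorem mem_spell {x y : α} {e : Bool} {p : α × Bool} (h : p ∈ spell x y e) :
    (p.1 = x ∨ p.1 = y) ∧ p.2 = e := by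
  cases e
  · simpa using mem_uWord (mem_invRev.1 (by simpa [spell] using h))
  · exact mem_uWord (by simpa [spell] using h)

theorem isReduced_spell (x y : α) (e : Bool) : IsReduced (spell x y e) :=
  isReduced_of_sign fun _ hp => (mem_spell hp).2

theorem eq_offset_of_infix_spell {x y : α} (hxy : x ≠ y) {e : Bool} {s s' v t t' : Word α}
    (h : spell x y e = s ++ v ++ t) (h' : spell x y e = s' ++ v ++ t') (hv : 203 ≤ v.length) :
    s.length = s'.length := by
  cases e
  · have e1 := congrArg invRev h
    have e2 := congrArg invRev h'
    have l1 := congrArg List.length h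
    have l2 := congrArg List.length h'
    simp only [invRev_spell, FreeGroup.invRev_append, Bool.not_false] at e1 e2
    simp only [spell, if_true, ← List.append_assoc] at e1 e2
    have := eq_offset_of_infix_uWord hxy e1.symm e2.symm (by simpa using hv)
    simp only [invRev_length, List.length_append] at *
    omega
  · simp only [spell, if_true] at h h'
    exact eq_offset_of_infix_uWord hxy h.symm h'.symm hv

theorem onArc_of_prefix_suffix {x y z : α} {e : Bool} {c d s t : Word α}
    (h : spell x y e = c ++ t) (h' : spell x y e = s ++ d) :
    OnArc x y z (invRev c ++ (z, e) :: invRev d) := by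
  cases e
  · left
    have h1 := congrArg invRev h
    have h2 := congrArg invRev h'
    simp only [invRev_spell, FreeGroup.invRev_append, Bool.not_false] at h1 h2
    simp only [spell, if_true] at h1 h2
    refine ⟨invRev t, invRev s, ?_⟩
    rw [arc]
    nth_rw 1 [h1]
    rw [h2]
    simp
  · right
    simp only [spell, if_true] at h h'
    refine ⟨s, t, ?_⟩
    rw [arc]
    nth_rw 1 [h']
    rw [h]
    simp [FreeGroup.invRev, Function.comp_def]

theorem length_le_of_onArc_of_forall_ne {x y z : α} {v : Word α} (ha : OnArc x y z v)
    (hv : ∀ p ∈ v, p.1 ≠ y) : v.length ≤ 202 := by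
  have key : ∀ v : Word α, v <:+: arc x y z → (∀ p ∈ v, p.1 ≠ y) → v.length ≤ 202 := by
    intro v ha hv
    rw [arc, show uWord x y ++ (z, false) :: uWord x y = uWord x y ++ ([(z, false)] ++ uWord x y)
      by simp] at ha
    obtain ⟨v₁, v₂, rfl, h₁, h₂⟩ := exists_of_infix_append ha
    obtain ⟨v₂, v₃, rfl, h₂, h₃⟩ := exists_of_infix_append h₂
    have l₁ := length_le_of_infix_uWord h₁ fun p hp => hv p (by simp [hp])
    have l₃ := length_le_of_infix_uWord h₃ fun p hp => hv p (by simp [hp])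
    have l₂ := h₂.length_le
    simp only [List.length_append, List.length_singleton] at *
    omega
  rcases ha with h | h
  · exact key v h hv
  · rw [← invRev_length]
    exact key _ h fun p hp => hv (p.1, !p.2) (mem_invRev.1 hp)

variable [DecidableEq α]

theorem two_le_occ_of_infix_spell {x y : α} {e : Bool} {v : Word α}
    (h : v <:+: spell x y e) (hv : 4 ≤ v.length) : 2 ≤ occ x v := by
  cases e
  · rw [← occ_invRev]
    refine two_le_occ_of_infix_uWord (y := y) ?_ (by simpa using hv)
    simpa [spell] using invRev_isInfix h
  · exact two_le_occ_of_infix_uWord (y := y) (by simpa [spell] using h) hv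

theorem OnArc.occ_le {x y z : α} {v : Word α} (h : OnArc x y z v) (c : α) :
    occ c v ≤ occ c (arc x y z) := by
  rcases h with h | h
  · exact occ_le_of_isInfix h
  · rw [← occ_invRev]
    exact occ_le_of_isInfix h

theorem occ_arc_right {x y z : α} (hxy : x ≠ y) (hyz : y ≠ z) : occ y (arc x y z) = 200 := by
  rw [arc, occ_append, occ_uWord_right hxy, occ, List.countP_cons, ← occ, occ_uWord_right hxy]
  simp [hyz.symm]

theorem occ_arc_last {x y z : α} (hxz : x ≠ z) (hyz : y ≠ z) : occ z (arc x y z) = 1 := by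
  have h : occ z (uWord x y) = 0 := occ_eq_zero fun p hp e => by
    rcases (mem_uWord hp).1 with h | h
    · exact hxz (h.symm.trans e)
    · exact hyz (h.symm.trans e)
  rw [arc, occ_append, h, occ, List.countP_cons, ← occ, h]
  simp

/-- An upper bound on the number of letters other than `y` in the common subwords of `W` and the
cyclic word `u(x,y) z⁻¹`. -/
def Good (T : ℕ) (x y z : α) (W : Word α) : Prop :=
  ∀ v, v <:+: W → OnArc x y z v → cnt y v ≤ T

theorem Good.mono {T T' : ℕ} {x y z : α} {W : Word α} (h : Good T x y z W) (hT : T ≤ T') :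
    Good T' x y z W := fun v hv ha => (h v hv ha).trans hT

theorem Good.of_isInfix {T : ℕ} {x y z : α} {W W' : Word α} (h : Good T x y z W) (hW : W' <:+: W) :
    Good T x y z W' := fun v hv ha => h v (hv.trans hW) ha

theorem Good.append {T T' : ℕ} {x y z : α} {W W' : Word α} (h : Good T x y z W)
    (h' : Good T' x y z W') : Good (T + T') x y z (W ++ W') := by
  intro v hv ha
  obtain ⟨v₁, v₂, rfl, h₁, h₂⟩ := exists_of_infix_append hv
  rw [cnt_append]
  exact add_le_add (h v₁ h₁ (ha.of_isInfix ⟨[], v₂, by simp⟩))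
    (h' v₂ h₂ (ha.of_isInfix ⟨v₁, [], by simp⟩))

theorem good_one_of_forall_ne {x y z : α} {W : Word α} (hxz : x ≠ z) (hyz : y ≠ z)
    (h : ∀ p ∈ W, p.1 ≠ x) : Good 1 x y z W := by
  intro v hv ha
  rw [← occ_arc_last hxz hyz]
  refine le_trans ?_ (ha.occ_le z)
  refine List.countP_mono_left fun p hp hpy => ?_
  rcases ha.mem hp with h1 | h1 | h1
  · exact absurd h1 (h p (hv.subset hp))
  · simp [h1] at hpy
  · simpa using h1

theorem good_zero_of_forall_ne {x y z : α} {W : Word α}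
    (h : ∀ p ∈ W, p.1 ≠ x ∧ p.1 ≠ z) : Good 0 x y z W := by
  intro v hv ha
  refine (cnt_eq_zero fun p hp => ?_).le
  have := h p (hv.subset hp)
  have := ha.mem hp
  tauto

theorem good_of_forall_ne_right {x y z : α} {W : Word α} (h : ∀ p ∈ W, p.1 ≠ y) :
    Good 202 x y z W := fun _ hv ha =>
  (List.countP_le_length).trans
    (length_le_of_onArc_of_forall_ne ha fun p hp => h p (hv.subset hp))

end Arcs

end SmallCancellation

namespace SmallCancellation

open FreeGroup (IsReduced invRev invRev_invRev invRev_length)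

section Substitution

variable {α : Type} [DecidableEq α]

/-- The substitution `z ↦ u(x,y)` fixing all other letters. -/
def subst (x y z : α) : FreeGroup α →* FreeGroup α :=
  FreeGroup.lift fun c => if c = z then FreeGroup.mk (uWord x y) else FreeGroup.of c

theorem subst_of_forall_ne {x y z : α} {W : Word α} (h : ∀ p ∈ W, p.1 ≠ z) :
    subst x y z (FreeGroup.mk W) = FreeGroup.mk W := by
  induction W with
  | nil => exact map_one _
  | cons p W ih =>
    rw [show p :: W = [p] ++ W from rfl, mk_append, map_mul, ih fun q hq => h q (by simp [hq])]
    congr 1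
    have := h p (by simp)
    obtain ⟨c, e⟩ := p
    cases e <;> simp [subst, this, FreeGroup.of, FreeGroup.invRev]

theorem subst_letter (x y z : α) (e : Bool) :
    subst x y z (FreeGroup.mk [(z, e)]) = FreeGroup.mk (spell x y e) := by
  cases e <;> simp [subst, spell]

/-- The subwords of `R` containing at most one letter `x` come, up to letters `x` and `y` at both
ends, from subwords of `W` free of `z`. -/
def Traces (x y z : α) (W R : Word α) : Prop :=
  ∀ v, v <:+: R → occ x v ≤ 1 → ∃ l m r, v = l ++ m ++ r ∧ (∀ p ∈ l, p.1 = x ∨ p.1 = y) ∧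
    (∀ p ∈ r, p.1 = x ∨ p.1 = y) ∧ m <:+: W ∧ ∀ p ∈ m, p.1 ≠ z

theorem Traces.mono {x y z : α} {W W' R R' : Word α} (h : Traces x y z W R) (hW : W <:+: W')
    (hR : R' <:+: R) : Traces x y z W' R' := by
  intro v hv ho
  obtain ⟨l, m, r, e, hl, hr, hm, hz⟩ := h v (hv.trans hR) ho
  exact ⟨l, m, r, e, hl, hr, hm.trans hW, hz⟩

theorem traces_append {x y z : α} {W L M R : Word α} (hL : ∀ p ∈ L, p.1 = x ∨ p.1 = y)
    (hR : ∀ p ∈ R, p.1 = x ∨ p.1 = y) (hM : M <:+: W) (hz : ∀ p ∈ M, p.1 ≠ z) :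
    Traces x y z W (L ++ M ++ R) := by
  intro v hv _
  obtain ⟨v₁, r, rfl, h₁, h₂⟩ := exists_of_infix_append hv
  obtain ⟨l, m, rfl, h₁, h₃⟩ := exists_of_infix_append h₁
  exact ⟨l, m, r, rfl, fun p hp => hL p (h₁.subset hp), fun p hp => hR p (h₂.subset hp),
    h₃.trans hM, fun p hp => hz p (h₃.subset hp)⟩

theorem Traces.glue {x y z : α} {W A M C : Word α} (h₁ : Traces x y z W (A ++ M))
    (h₂ : Traces x y z W (M ++ C)) (hM : 2 ≤ occ x M) : Traces x y z W (A ++ M ++ C) := by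
  intro v hv ho
  rcases infix_append_of_count_lt (fun p => p.1 = x) hv (by unfold occ at *; omega) with h | h
  · exact h₁ v h ho
  · exact h₂ v h ho

/-- The result `π ρ` of substituting in the word `z^e rest`; here `a` is the part of `rest` that is
cancelled by the value of `z^e`. -/
def HeadForm (x y z : α) (e : Bool) (rest π γ a ρ : Word α) : Prop :=
  spell x y e = π ++ γ ++ invRev a ∧ a <+: rest ∧ γ.length ≤ 203 ∧
    subst x y z (FreeGroup.mk ((z, e) :: rest)) = FreeGroup.mk (π ++ ρ) ∧ IsReduced (π ++ ρ) ∧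
    Traces x y z ((z, e) :: rest) (π ++ ρ)

/-- The result `p π ρ` of substituting in the word `W = p b z^e rest`, where `z^e` is the first
letter `z^{±1}` of `W`, and `b` and `a` are the parts of `W` cancelled by the value of `z^e`. -/
def FirstForm (x y z : α) (W p b : Word α) (e : Bool) (rest π γ a ρ : Word α) : Prop :=
  W = p ++ b ++ (z, e) :: rest ∧ (∀ q ∈ p, q.1 ≠ z) ∧
    spell x y e = invRev b ++ π ++ γ ++ invRev a ∧ a <+: rest ∧ γ.length ≤ 203 ∧
    b.length + a.length ≤ 3200 ∧
    subst x y z (FreeGroup.mk W) = FreeGroup.mk (p ++ π ++ ρ) ∧ IsReduced (p ++ π ++ ρ) ∧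
    Traces x y z W (p ++ π ++ ρ)

theorem length_add_le_of_good {x y z : α} (hxy : x ≠ y) (hyz : y ≠ z) {W : Word α}
    (hW : Good 3000 x y z W) {e : Bool} {b a s t : Word α} (hb : spell x y e = invRev b ++ t)
    (ha : spell x y e = s ++ invRev a) (h : b ++ (z, e) :: a <:+: W) :
    b.length + a.length ≤ 3200 := by
  have harc : OnArc x y z (b ++ (z, e) :: a) := by
    simpa using onArc_of_prefix_suffix (z := z) hb ha
  have h1 := hW _ h harc
  have h2 := harc.occ_le y
  rw [occ_arc_right hxy hyz] at h2
  have h3 := cnt_add_occ y (b ++ (z, e) :: a)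
  simp only [List.length_append, List.length_cons] at h3
  omega

theorem HeadForm.exists_firstForm {x y z : α} (hxy : x ≠ y) (hyz : y ≠ z)
    {p : Word α} (hp : ∀ q ∈ p, q.1 ≠ z) {e : Bool} {rest π₀ γ a ρ₀ : Word α}
    (hred : IsReduced (p ++ (z, e) :: rest)) (hW : Good 3000 x y z (p ++ (z, e) :: rest))
    (h : HeadForm x y z e rest π₀ γ a ρ₀) :
    ∃ p' b π ρ, FirstForm x y z (p ++ (z, e) :: rest) p' b e rest π γ a ρ := by
  obtain ⟨hE, ⟨a', ha⟩, hγ, hs, hr, hB⟩ := h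
  obtain ⟨p', b, s', rfl, hs', hr'⟩ := exists_cancellation (hred.of_isInfix ⟨[], _, rfl⟩) hr
  have hlen := congrArg List.length hE
  simp only [length_spell, List.length_append, invRev_length] at hlen
  -- the cancellation stays inside of `π₀`
  obtain ⟨π, rfl, rfl⟩ : ∃ π, π₀ = invRev b ++ π ∧ s' = π ++ ρ₀ := by
    rcases List.append_eq_append_iff.1 hs' with ⟨u, hu, rfl⟩ | ⟨u, rfl, rfl⟩
    · exfalso
      have hb : b = invRev u ++ invRev π₀ := by
        rw [← FreeGroup.invRev_append, ← hu, invRev_invRev]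
      have := length_add_le_of_good hxy hyz hW (e := e) (b := invRev π₀) (a := a) (s := π₀ ++ γ)
        (t := γ ++ invRev a) (by simpa using hE) hE
        ⟨p' ++ invRev u, a', by rw [← ha, hb]; simp⟩
      simp only [invRev_length] at this
      omega
    · exact ⟨u, rfl, rfl⟩
  have hab := length_add_le_of_good hxy hyz hW (e := e) (b := b) (a := a) (s := invRev b ++ π ++ γ)
    (t := π ++ γ ++ invRev a) (by simpa using hE) hE ⟨p', a', by rw [← ha]; simp⟩
  simp only [List.length_append, invRev_length] at hlen
  have hπ : π <:+: spell x y e := ⟨invRev b, γ ++ invRev a, by simp [hE]⟩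
  refine ⟨p', b, π, ρ₀, by simp, fun q hq => hp q (by simp [hq]), hE, ⟨a', ha⟩, hγ, hab, ?_,
    by simpa using hr', ?_⟩
  · rw [mk_append, map_mul, hs, subst_of_forall_ne hp, hs', mk_append, mk_append, mk_append,
      mk_append, mk_append, mk_invRev]
    group
  · refine Traces.glue ?_ (hB.mono ⟨p' ++ b, [], by simp⟩ ⟨invRev b, [], by simp⟩)
      (two_le_occ_of_infix_spell hπ (by omega))
    have := traces_append (x := x) (y := y) (z := z) (W := p' ++ b ++ (z, e) :: rest) (L := [])
      (M := p') (R := π) (by simp) (fun q hq => (mem_spell (hπ.subset hq)).1)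
      ⟨[], b ++ (z, e) :: rest, by simp⟩ fun q hq => hp q (by simp [hq])
    simpa using this

theorem exists_headForm_of_forall_ne {x y z : α} {e : Bool} {rest : Word α}
    (hred : IsReduced ((z, e) :: rest)) (h : ∀ q ∈ rest, q.1 ≠ z) :
    ∃ π γ a ρ, HeadForm x y z e rest π γ a ρ := by
  obtain ⟨π, c, ρ, hE, hc, hr⟩ := exists_cancellation (isReduced_spell x y e)
    (hred.of_isInfix (L' := rest) ⟨[(z, e)], [], by simp⟩)
  refine ⟨π, [], invRev c, ρ, by simpa using hE, ⟨ρ, hc.symm⟩, by simp, ?_, hr, ?_⟩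
  · rw [show (z, e) :: rest = [(z, e)] ++ rest from rfl, mk_append, map_mul, subst_letter,
      subst_of_forall_ne h, hE, hc, mk_append, mk_append, mk_append, mk_invRev]
    group
  · have := traces_append (x := x) (y := y) (z := z) (W := (z, e) :: rest) (L := π)
      (M := ρ) (R := []) (fun q hq => (mem_spell (e := e) (hE ▸ by simp [hq])).1) (by simp)
      ⟨(z, e) :: invRev c, [], by simp [hc]⟩ fun q hq => h q (by simp [hc, hq])
    simpa using this

theorem FirstForm.exists_headForm {x y z : α} (hxy : x ≠ y)
    {e e' : Bool} {W p b rest π' γ' a' ρ' : Word α} (hred : IsReduced ((z, e) :: W))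
    (h : FirstForm x y z W p b e' rest π' γ' a' ρ') :
    ∃ π γ a ρ, HeadForm x y z e W π γ a ρ := by
  obtain ⟨rfl, hp, hE', ha', hγ', hab, hs, hr, hB⟩ := h
  obtain ⟨π, c, ρ, hE, hc, hr'⟩ := exists_cancellation (isReduced_spell x y e) hr
  have hlen := congrArg List.length hE'
  simp only [length_spell, List.length_append, invRev_length] at hlen
  have hσ : subst x y z (FreeGroup.mk ((z, e) :: (p ++ b ++ (z, e') :: rest))) =
      FreeGroup.mk (π ++ ρ) := by
    rw [show (z, e) :: (p ++ b ++ (z, e') :: rest) = [(z, e)] ++ (p ++ b ++ (z, e') :: rest) from rfl,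
      mk_append, map_mul, subst_letter, hs, hE, hc, mk_append, mk_append, mk_append, mk_invRev]
    group
  have hWi : p ++ b ++ (z, e') :: rest <:+: (z, e) :: (p ++ b ++ (z, e') :: rest) :=
    ⟨[(z, e)], [], by simp⟩
  have hπ : ∀ q ∈ π, q.1 = x ∨ q.1 = y := fun q hq => (mem_spell (e := e) (hE ▸ by simp [hq])).1
  have hπ' : π' <:+: spell x y e' := ⟨invRev b, γ' ++ invRev a', by simp [hE']⟩
  rw [List.append_assoc] at hc
  rcases List.append_eq_append_iff.1 hc with ⟨k, hk, hρ⟩ | ⟨m, rfl, rfl⟩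
  · -- the cancellation reaches the value of `z^e'`
    have hkE : spell x y e = π ++ invRev k ++ invRev p := by
      rw [hE, List.append_assoc, ← FreeGroup.invRev_append, ← hk, invRev_invRev]
    have hk203 : k.length ≤ 203 := by
      by_contra hlt
      obtain ⟨k₁, k₂, rfl, hk₁⟩ : ∃ k₁ k₂, k = k₁ ++ k₂ ∧ k₁.length = 203 :=
        ⟨k.take 203, k.drop 203, by simp, by simp; omega⟩
      obtain ⟨π₂, rfl⟩ : k₁ <+: π' := by
        refine List.prefix_of_prefix_length_le (l₃ := π' ++ ρ') ?_ (List.prefix_append _ _) (by omega)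
        exact ⟨k₂ ++ ρ, by simp [hρ]⟩
      obtain ⟨q, k₃, rfl⟩ : ∃ q k₃, k₁ = q :: k₃ := by
        cases k₁ with
        | nil => simp at hk₁
        | cons q k₃ => exact ⟨q, k₃, rfl⟩
      have hq' : q.2 = e' := (mem_spell (x := x) (y := y) (by rw [hE']; simp)).2
      have hq : (!q.2) = e := by
        refine (mem_spell (x := x) (y := y) (p := (q.1, !q.2)) (by
          rw [hkE]
          simp only [List.mem_append, mem_invRev]
          simp)).2
      have hee : e = !e' := by rw [← hq, hq']
      have hkE' : spell x y e' = p ++ (q :: k₃) ++ (k₂ ++ invRev π) := by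
        have := congrArg invRev hkE
        rw [invRev_spell, hee] at this
        simpa [FreeGroup.invRev_append] using this
      have hoff := eq_offset_of_infix_spell hxy hkE' (s' := invRev b)
        (t' := π₂ ++ γ' ++ invRev a') (by simpa using hE') hk₁.ge
      have hpb : p = invRev b := by
        rw [hkE', List.append_assoc] at hE'
        simp only [List.append_assoc] at hE'
        exact (List.append_inj hE' hoff).1
      have hbb : IsReduced (invRev b ++ b) :=
        hred.of_isInfix ⟨[(z, e)], (z, e') :: rest, by simp [hpb]⟩
      have hb := eq_nil_of_isReduced_invRev_append hbb
      subst hb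
      subst hpb
      have : IsReduced [(z, e), (z, e')] := hred.of_isInfix ⟨[], rest, by simp⟩
      simp [FreeGroup.IsReduced, hee] at this
    obtain ⟨π₂, rfl, rfl⟩ : ∃ π₂, π' = k ++ π₂ ∧ ρ = π₂ ++ ρ' := by
      rcases List.append_eq_append_iff.1 hρ with ⟨u, rfl, rfl⟩ | ⟨u, rfl, rfl⟩
      · have : u = [] := List.eq_nil_of_length_eq_zero (by simp at hk203; omega)
        subst this
        exact ⟨[], by simp, by simp⟩
      · exact ⟨u, rfl, rfl⟩
    simp only [List.length_append] at hlen
    have hπ₂ : π₂ <:+: spell x y e' := List.IsInfix.trans ⟨k, [], by simp⟩ hπ'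
    refine ⟨π, invRev k, p, π₂ ++ ρ', hkE, ⟨b ++ (z, e') :: rest, by simp⟩, by simpa using hk203,
      hσ, hr', ?_⟩
    rw [← List.append_assoc]
    refine Traces.glue ?_ (hB.mono hWi ⟨p ++ k, [], by simp⟩)
      (two_le_occ_of_infix_spell hπ₂ (by omega))
    have := traces_append (x := x) (y := y) (z := z)
      (W := (z, e) :: (p ++ b ++ (z, e') :: rest)) (L := π) (M := []) (R := π₂) hπ
      (fun q hq => (mem_spell (hπ₂.subset hq)).1) List.nil_infix (by simp)
    simpa using this
  · refine ⟨π, [], invRev c, m ++ (π' ++ ρ'), by simpa using hE,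
      ⟨m ++ b ++ (z, e') :: rest, by simp⟩, by simp, hσ, hr', ?_⟩
    rw [← List.append_assoc, ← List.append_assoc]
    refine Traces.glue ?_ (hB.mono hWi ⟨invRev c ++ m, [], by simp⟩)
      (two_le_occ_of_infix_spell hπ' (by omega))
    exact traces_append hπ (fun q hq => (mem_spell (hπ'.subset hq)).1)
      ⟨(z, e) :: invRev c, b ++ (z, e') :: rest, by simp⟩ fun q hq => hp q (by simp [hq])

theorem exists_first_occurrence (z : α) (W : Word α) : (∀ q ∈ W, q.1 ≠ z) ∨
    ∃ p e rest, W = p ++ (z, e) :: rest ∧ ∀ q ∈ p, q.1 ≠ z := by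
  induction W with
  | nil => simp
  | cons q W ih =>
    by_cases hq : q.1 = z
    · exact .inr ⟨[], q.2, W, by simp [← hq], by simp⟩
    · rcases ih with h | ⟨p, e, rest, rfl, hp⟩
      · exact .inl (List.forall_mem_cons.2 ⟨hq, h⟩)
      · exact .inr ⟨q :: p, e, rest, rfl, List.forall_mem_cons.2 ⟨hq, hp⟩⟩

theorem exists_firstForm {x y z : α} (hxy : x ≠ y) (hyz : y ≠ z) (W : Word α)
    (hred : IsReduced W) (hW : Good 3000 x y z W) : (∀ q ∈ W, q.1 ≠ z) ∨
      ∃ p b e rest π γ a ρ, FirstForm x y z W p b e rest π γ a ρ := by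
  induction hn : W.length using Nat.strong_induction_on generalizing W with
  | _ n ih =>
    rcases exists_first_occurrence z W with h | ⟨p, e, rest, rfl, hp⟩
    · exact .inl h
    right
    have hred' : IsReduced ((z, e) :: rest) := hred.of_isInfix ⟨p, [], by simp⟩
    have hi : rest <:+: p ++ (z, e) :: rest := ⟨p ++ [(z, e)], [], by simp⟩
    obtain ⟨π, γ, a, ρ, h⟩ : ∃ π γ a ρ, HeadForm x y z e rest π γ a ρ := by
      rcases ih rest.length (by simp at hn; omega) rest (hred.of_isInfix hi) (hW.of_isInfix hi) rfl with
        h | ⟨p', b', e', rest', π', γ', a', ρ', h⟩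
      · exact exists_headForm_of_forall_ne hred' h
      · exact h.exists_headForm hxy hred'
    obtain ⟨p', b, π, ρ, h⟩ := h.exists_firstForm hxy hyz hp hred hW
    exact ⟨p', b, e, rest, π, γ, a, ρ, h⟩

/-- Substituting `u(x,y)` for `z` in a nonempty reduced word that contains no long subwords of the
relator `u(x,y) z⁻¹` leads to a nonempty reduced word. -/
theorem exists_subst {x y z : α} (hxy : x ≠ y) (hyz : y ≠ z) {W : Word α}
    (hred : IsReduced W) (hW : Good 3000 x y z W) :
    ∃ R, IsReduced R ∧ FreeGroup.mk R = subst x y z (FreeGroup.mk W) ∧ (W ≠ [] → R ≠ []) ∧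
      Traces x y z W R := by
  rcases exists_firstForm hxy hyz W hred hW with h | ⟨p, b, e, rest, π, γ, a, ρ, h⟩
  · refine ⟨W, hred, (subst_of_forall_ne h).symm, id, ?_⟩
    simpa using traces_append (x := x) (y := y) (L := []) (R := []) (by simp) (by simp)
      List.infix_rfl h
  · obtain ⟨rfl, hp, hE, ha, hγ, hab, hs, hr, hB⟩ := h
    refine ⟨p ++ π ++ ρ, hr, hs.symm, fun _ h0 => ?_, hB⟩
    have hlen := congrArg List.length hE
    simp only [length_spell, List.length_append, invRev_length] at hlen
    have h1 := congrArg List.length h0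
    simp only [List.length_append, List.length_nil] at h1
    omega

end Substitution

end SmallCancellation

namespace SmallCancellation

section Pushout

open Monoid (PushoutI)

variable {ι H β : Type} [Group H] {G : ι → Type} [∀ i, Group (G i)] {φ : ∀ i, H →* G i}

theorem exists_pushout_blocks {tag : β → Option ι} {bv : β → H} {gv : ∀ i, β → G i}
    {pv : β → PushoutI φ} (hgv : ∀ b i, tag b = none → gv i b = φ i (bv b))
    (hnone : ∀ b, tag b = none → pv b = PushoutI.base φ (bv b))
    (hsome : ∀ b i, tag b = some i → pv b = PushoutI.of i (gv i b)) (L : List β)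
    (hL : ∀ i h, h <:+: L → (∃ b ∈ h.head?, tag b = some i) → (∃ b ∈ h.getLast?, tag b = some i) →
      (∀ b ∈ h, tag b = none ∨ tag b = some i) → (h.map (gv i)).prod ∉ (φ i).range) :
    (∀ b ∈ L, tag b = none) ∨ ∃ L₀ h L₁ i f, ∃ l : List (Σ i, G i), L = L₀ ++ h ++ L₁ ∧
      (∀ b ∈ L₀, tag b = none) ∧ (∃ b ∈ h.head?, tag b = some i) ∧
      (∃ b ∈ h.getLast?, tag b = some i) ∧ (∀ b ∈ h, tag b = none ∨ tag b = some i) ∧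
      (∀ s ∈ l.head?, i ≠ s.1) ∧ l.IsChain (fun s t => s.1 ≠ t.1) ∧
      (∀ s ∈ l, s.2 ∉ (φ s.1).range) ∧
      (L.map pv).prod = PushoutI.base φ (L₀.map bv).prod *
        (PushoutI.of i ((h.map (gv i)).prod * φ i f) *
          (l.map fun s => PushoutI.of (φ := φ) s.1 s.2).prod) := by
  have hbase : ∀ L : List β, (∀ b ∈ L, tag b = none) →
      (L.map pv).prod = PushoutI.base φ (L.map bv).prod := by
    intro L hL
    rw [map_list_prod, List.map_map]
    exact congrArg _ (List.map_congr_left fun b hb => hnone b (hL b hb))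
  induction L with
  | nil => simp
  | cons b L ih =>
    have hb1 : ∀ i, tag b = some i → gv i b ∉ (φ i).range := fun i hi => by
      simpa using hL i [b] ⟨[], L, by simp⟩ ⟨b, by simp, hi⟩ ⟨b, by simp, hi⟩ (by simp [hi])
    rcases ih fun i h hh => hL i h (hh.trans ⟨[b], [], by simp⟩) with
      hall | ⟨L₀, h, L₁, j, f, l, rfl, hL₀, hhead, hlast, htag, hl, hchain, hnr, hprod⟩
    · cases hb : tag b with
      | none => exact .inl (List.forall_mem_cons.2 ⟨hb, hall⟩)
      | some i =>
        refine .inr ⟨[], [b], L, i, (L.map bv).prod, [], by simp, by simp, by simp [hb],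
          by simp [hb], by simp [hb], by simp, by simp, by simp, ?_⟩
        rw [List.map_cons, List.prod_cons, hbase L hall, hsome b i hb]
        simp [PushoutI.of_apply_eq_base]
    · cases hb : tag b with
      | none =>
        refine .inr ⟨b :: L₀, h, L₁, j, f, l, by simp, List.forall_mem_cons.2 ⟨hb, hL₀⟩, hhead,
          hlast, htag, hl, hchain, hnr, ?_⟩
        rw [List.map_cons, List.prod_cons, hprod, hnone b hb]
        simp [mul_assoc]
      | some i =>
        right
        by_cases hij : i = j
        · subst hij
          refine ⟨[], b :: L₀ ++ h, L₁, i, f, l, by simp, by simp, ⟨b, by simp, hb⟩, ?_, ?_, hl,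
            hchain, hnr, ?_⟩
          · obtain ⟨c, hc, hc'⟩ := hlast
            exact ⟨c, List.mem_getLast?_append_of_mem_getLast? hc, hc'⟩
          · intro c hc
            rcases List.mem_append.1 hc with hc | hc
            · rcases List.mem_cons.1 hc with rfl | hc
              · exact .inr hb
              · exact .inl (hL₀ c hc)
            · exact htag c hc
          · have e : (L₀.map (gv i)).prod = φ i (L₀.map bv).prod := by
              rw [map_list_prod, List.map_map]
              exact congrArg _ (List.map_congr_left fun c hc => hgv c i (hL₀ c hc))
            rw [List.map_cons, List.prod_cons, hprod, hsome b i hb]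
            simp [e, PushoutI.of_apply_eq_base, mul_assoc]
        · refine ⟨[], [b], L₀ ++ h ++ L₁, i, (L₀.map bv).prod, ⟨j, (h.map (gv j)).prod * φ j f⟩ :: l,
            by simp, by simp, by simp [hb], by simp [hb], by simp [hb], by simpa using hij,
            List.isChain_cons.2 ⟨hl, hchain⟩, ?_, ?_⟩
          · refine List.forall_mem_cons.2 ⟨?_, hnr⟩
            rw [Subgroup.mul_mem_cancel_right _ (MonoidHom.mem_range.2 ⟨f, rfl⟩)]
            exact hL j h ⟨b :: L₀, L₁, by simp⟩ hhead hlast htag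
          · rw [List.map_cons, List.prod_cons, hprod, hsome b i hb]
            simp [PushoutI.of_apply_eq_base, mul_assoc]

/-- A word over the factors of an amalgamated product represents an element of the base group only
if it contains a block over one factor representing an element of the base group. -/
theorem exists_block_of_mem_range_base (hφ : ∀ i, Function.Injective (φ i))
    {tag : β → Option ι} {bv : β → H} {gv : ∀ i, β → G i}
    {pv : β → PushoutI φ} (hgv : ∀ b i, tag b = none → gv i b = φ i (bv b))
    (hnone : ∀ b, tag b = none → pv b = PushoutI.base φ (bv b))
    (hsome : ∀ b i, tag b = some i → pv b = PushoutI.of i (gv i b)) {L : List β}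
    (hL : (L.map pv).prod ∈ (PushoutI.base φ).range) (hne : ∃ b ∈ L, tag b ≠ none) :
    ∃ i h, h <:+: L ∧ (∃ b ∈ h.head?, tag b = some i) ∧ (∃ b ∈ h.getLast?, tag b = some i) ∧
      (∀ b ∈ h, tag b = none ∨ tag b = some i) ∧ (h.map (gv i)).prod ∈ (φ i).range := by
  by_contra hcon
  have hcon' : ∀ i h, h <:+: L → (∃ b ∈ h.head?, tag b = some i) →
      (∃ b ∈ h.getLast?, tag b = some i) → (∀ b ∈ h, tag b = none ∨ tag b = some i) →
      (h.map (gv i)).prod ∉ (φ i).range :=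
    fun i h h1 h2 h3 h4 h5 => hcon ⟨i, h, h1, h2, h3, h4, h5⟩
  rcases exists_pushout_blocks hgv hnone hsome L hcon' with
    hall | ⟨L₀, h, L₁, i, f, l, rfl, hL₀, hhead, hlast, htag, hl, hchain, hnr, hprod⟩
  · obtain ⟨b, hb, hb'⟩ := hne
    exact hb' (hall b hb)
  have hnr' : ∀ s ∈ (⟨i, (h.map (gv i)).prod * φ i f⟩ :: l : List (Σ i, G i)),
      s.2 ∉ (φ s.1).range := by
    refine List.forall_mem_cons.2 ⟨?_, hnr⟩
    rw [Subgroup.mul_mem_cancel_right _ (MonoidHom.mem_range.2 ⟨f, rfl⟩)]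
    exact hcon' i h ⟨L₀, L₁, by simp⟩ hhead hlast htag
  let w : Monoid.CoprodI.Word G :=
    ⟨⟨i, (h.map (gv i)).prod * φ i f⟩ :: l,
      fun s hs h1 => hnr' s hs (h1 ▸ one_mem _), List.isChain_cons.2 ⟨hl, hchain⟩⟩
  have hw : PushoutI.Reduced φ w := hnr'
  have hwp : PushoutI.ofCoprodI w.prod = PushoutI.of i ((h.map (gv i)).prod * φ i f) *
      (l.map fun s => PushoutI.of (φ := φ) s.1 s.2).prod := by
    rw [Monoid.CoprodI.Word.prod, map_list_prod, List.map_map]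
    simp [w, Function.comp_def]
  have hwr : PushoutI.ofCoprodI w.prod ∈ (PushoutI.base φ).range := by
    rw [hprod, Subgroup.mul_mem_cancel_left _ (MonoidHom.mem_range.2 ⟨_, rfl⟩)] at hL
    rwa [hwp]
  have := congrArg Monoid.CoprodI.Word.toList (hw.eq_empty_of_mem_range hφ hwr)
  simp [w, Monoid.CoprodI.Word.empty] at this

end Pushout

end SmallCancellation

namespace SmallCancellation

open FreeGroup (IsReduced invRev invRev_invRev invRev_length)
open Monoid (PushoutI)

section Maps

variable {α β : Type}

theorem isReduced_of_map (f : α → β) {W : Word α}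
    (h : IsReduced (W.map fun p => (f p.1, p.2))) : IsReduced W := by
  unfold FreeGroup.IsReduced at *
  rw [List.isChain_map] at h
  exact h.imp fun p q hpq e => hpq (congrArg f e)

theorem isReduced_map {f : α → β} (hf : Function.Injective f) {W : Word α} (h : IsReduced W) :
    IsReduced (W.map fun p => (f p.1, p.2)) := by
  unfold FreeGroup.IsReduced at *
  rw [List.isChain_map]
  exact h.imp fun p q hpq e => hpq (hf e)

theorem exists_map_eq (f : α → β) {W : Word β} (h : ∀ q ∈ W, ∃ a, f a = q.1) :
    ∃ w : Word α, w.map (fun p => (f p.1, p.2)) = W := by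
  induction W with
  | nil => exact ⟨[], rfl⟩
  | cons q W ih =>
    obtain ⟨w, rfl⟩ := ih fun p hp => h p (by simp [hp])
    obtain ⟨a, ha⟩ := h q (by simp)
    exact ⟨(a, q.2) :: w, by simp [ha]⟩

theorem cnt_map [DecidableEq α] [DecidableEq β] {f : α → β} {y : α} (hf : ∀ c, f c = f y → c = y)
    (v : Word α) : cnt (f y) (v.map fun p => (f p.1, p.2)) = cnt y v := by
  rw [cnt, cnt, List.countP_map]
  refine List.countP_congr fun p _ => ?_
  simpa using not_congr ⟨hf p.1, fun e => congrArg f e⟩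

theorem Traces.mem [DecidableEq α] {x y z : α} {W R : Word α} (h : Traces x y z W R)
    {q : α × Bool} (hq : q ∈ R) : q.1 = x ∨ q.1 = y ∨ (q ∈ W ∧ q.1 ≠ z) := by
  obtain ⟨l, m, r, e, hl, hr, hm, hz⟩ := h [q] ((List.singleton_infix_iff _ _).2 hq)
    (List.countP_le_length)
  have : q ∈ l ++ m ++ r := by simp [← e]
  simp only [List.mem_append] at this
  rcases this with (h | h) | h
  · have := hl q h; tauto
  · exact .inr (.inr ⟨hm.subset h, hz q h⟩)
  · have := hr q h; tauto

variable {G Γ : Type} [Group G] [Group Γ]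

/-- The value of `u(x,y)` at `x = a` and `y = b`. -/
def evalU (a b : G) : G :=
  FreeGroup.lift (fun c : Bool => if c then a else b) (FreeGroup.mk (uWord true false))

theorem map_mk_uWord (f : FreeGroup α →* G) (x y : α) :
    f (FreeGroup.mk (uWord x y)) = evalU (f (FreeGroup.of x)) (f (FreeGroup.of y)) := by
  have h : FreeGroup.mk (uWord x y) =
      FreeGroup.map (fun c : Bool => if c then x else y) (FreeGroup.mk (uWord true false)) := by
    rw [FreeGroup.map.mk]
    exact congrArg _ (map_uWord (fun c : Bool => if c then x else y) true false).symm
  rw [h, evalU, ← MonoidHom.comp_apply]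
  congr 1
  ext c
  cases c <;> simp

theorem map_evalU (f : G →* Γ) (a b : G) : f (evalU a b) = evalU (f a) (f b) := by
  rw [evalU, evalU, ← MonoidHom.comp_apply]
  congr 1
  ext c
  cases c <;> simp

/-- The endomorphism `x ↦ u(x,y)`, `y ↦ y` of the free group on `x = true` and `y = false`. -/
def twist : FreeGroup Bool →* FreeGroup Bool :=
  FreeGroup.lift fun c => if c then FreeGroup.mk (uWord true false) else FreeGroup.of false

theorem twist_injective : Function.Injective twist := by
  rw [injective_iff_map_eq_one]
  intro g hg
  let i₀ : Bool → Option Bool := fun c => if c then none else some false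
  let W : Word (Option Bool) := g.toWord.map fun p => (i₀ p.1, p.2)
  have hW : IsReduced W := isReduced_map
    (by intro a b; cases a <;> cases b <;> simp [i₀]) FreeGroup.isReduced_toWord
  have hgood : Good 3000 (some true) (some false) none W := by
    refine (good_one_of_forall_ne (by simp) (by simp) fun p hp => ?_).mono (by simp)
    simp only [W, List.mem_map] at hp
    obtain ⟨q, -, rfl⟩ := hp
    cases q.1 <;> simp [i₀]
  obtain ⟨R, hR, hRs, hne, htr⟩ := exists_subst (by simp) (by simp) hW hgood
  obtain ⟨w, rfl⟩ := exists_map_eq (some : Bool → Option Bool) (W := R) fun q hq => by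
    rcases htr.mem hq with h | h | ⟨-, h⟩
    · exact ⟨_, h.symm⟩
    · exact ⟨_, h.symm⟩
    · exact ⟨q.1.get (Option.isSome_iff_ne_none.2 h), by simp⟩
  let back : FreeGroup (Option Bool) →* FreeGroup Bool := FreeGroup.map fun c => c.getD true
  have hcomp : (back.comp (subst (some true) (some false) none)).comp (FreeGroup.map i₀) = twist := by
    ext c
    cases c
    · simp [back, subst, twist, i₀]
    · simp only [back, subst, twist, i₀, MonoidHom.comp_apply, FreeGroup.map.of,
        FreeGroup.lift_apply_of, if_true, FreeGroup.map.mk]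
      exact congrArg _ (map_uWord (fun c : Option Bool => c.getD true) _ _)
  have h1 : back (subst (some true) (some false) none (FreeGroup.mk W)) = 1 := by
    rw [← hg, ← hcomp]
    simp only [MonoidHom.comp_apply]
    conv_rhs => rw [← FreeGroup.mk_toWord (x := g), FreeGroup.map.mk]
  rw [← hRs] at h1
  simp only [back, FreeGroup.map.mk, List.map_map, Function.comp_def, Option.getD_some,
    Prod.mk.eta, List.map_id'] at h1
  have hw := eq_nil_of_mk_eq_one (isReduced_of_map _ hR) h1
  have : W = [] := by
    by_contra h
    exact hne h (by simp [hw])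
  rw [← FreeGroup.toWord_eq_nil_iff]
  simpa [W] using this

end Maps

section Tower

variable {ι G : Type} [Group G]

/-- The small overlap condition for words in the letters `none` and `some p`, for `p` a vertex of
the tree of finite sequences, with respect to the words `u(some (p ++ [i]), none) (some p)⁻¹`. -/
def GoodTree [DecidableEq ι] (T : ℕ) (W : Word (Option (List ι))) : Prop :=
  ∀ p i, Good (if p = [] then T + 1 else T) (some (p ++ [i])) none (some p) W

/-- `val` assigns elements of `G` to `none` and to the vertices of the tree of finite sequences
such that `val (some p) = u(val (some (p ++ [i])), val none)` up to depth `d`, the values at `none`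
and at the root are free generators, and every word with small overlaps whose value lies in the
subgroup generated by these is a word in `none` and the root. -/
structure IsTreeOfRoots [DecidableEq ι] (d : ℕ) (base : FreeGroup Bool →* G)
    (val : Option (List ι) → G) : Prop where
  injective : Function.Injective base
  val_none : val none = base (FreeGroup.of false)
  val_root : val (some []) = base (FreeGroup.of true)
  val_parent : ∀ p i, p.length < d → val (some p) = evalU (val (some (p ++ [i]))) (val none)
  mem_root : ∀ (T : ℕ) (W : Word (Option (List ι))), T ≤ 2998 → IsReduced W →
    (∀ q ∈ W, ∀ p, q.1 = some p → p.length ≤ d) → GoodTree T W →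
    FreeGroup.lift val (FreeGroup.mk W) ∈ base.range → ∀ q ∈ W, q.1 = none ∨ q.1 = some []

/-- The letters of the words in the free generators at the bottom of the tree. -/
def rootLetter (ι : Type) (c : Bool) : Option (List ι) := if c then some [] else none

theorem rootLetter_injective : Function.Injective (rootLetter ι) := by
  intro a b
  cases a <;> cases b <;> simp [rootLetter]

theorem rootLetter_eq (c : Bool) : rootLetter ι c = none ∨ rootLetter ι c = some [] := by
  cases c <;> simp [rootLetter]

theorem lift_map {α β : Type} (val : β → G) (f : α → β) (W : Word α) :
    FreeGroup.lift val (FreeGroup.mk (W.map fun p => (f p.1, p.2))) =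
      FreeGroup.lift (val ∘ f) (FreeGroup.mk W) := by
  simp [FreeGroup.lift_mk, Function.comp_def]

theorem lift_rootLetter {base : FreeGroup Bool →* G} {val : Option (List ι) → G}
    (h0 : val none = base (FreeGroup.of false)) (h1 : val (some []) = base (FreeGroup.of true)) :
    FreeGroup.lift (val ∘ rootLetter ι) = base := by
  ext c
  cases c <;> simp [rootLetter, h0, h1]

theorem IsTreeOfRoots.eq_nil [DecidableEq ι] {d : ℕ} {base : FreeGroup Bool →* G}
    {val : Option (List ι) → G} (h : IsTreeOfRoots d base val) {T : ℕ} {W : Word (Option (List ι))}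
    (hT : T ≤ 2998) (hW : IsReduced W) (hd : ∀ q ∈ W, ∀ p, q.1 = some p → p.length ≤ d) (hgood : GoodTree T W)
    (h1 : FreeGroup.lift val (FreeGroup.mk W) = 1) : W = [] := by
  have hq := h.mem_root T W hT hW hd hgood (h1 ▸ one_mem _)
  obtain ⟨w, rfl⟩ := exists_map_eq (rootLetter ι) (W := W) fun q hqW => by
    rcases hq q hqW with e | e
    · exact ⟨false, by simp [rootLetter, e]⟩
    · exact ⟨true, by simp [rootLetter, e]⟩
  rw [lift_map, lift_rootLetter h.val_none h.val_root] at h1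
  rw [eq_nil_of_mk_eq_one (isReduced_of_map _ hW) (h.injective (h1.trans (map_one _).symm))]
  rfl

/-- The index of the subtree of the letter `c`. -/
def branch : Option (List ι) → Option ι
  | some (i :: _) => some i
  | _ => none

/-- The letter `c` of the subtree at `i` as a letter of the whole tree. -/
def graft (i : ι) : Option (List ι) → Option (List ι)
  | some p => some (i :: p)
  | none => none

/-- The values in `G` of the letters of one subtree and of the letters at the root. -/
def branchVal (base : FreeGroup Bool →* G) (val : Option (List ι) → G) : Option (List ι) → G
  | some (_ :: p) => val (some p)
  | some [] => base (twist (FreeGroup.of true))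
  | none => base (twist (FreeGroup.of false))

/-- The values of the letters of the tree in the amalgam of copies of `G`. -/
def amalgamVal (base : FreeGroup Bool →* G) (val : Option (List ι) → G) :
    Option (List ι) → PushoutI (fun _ : ι => base.comp twist)
  | some (i :: p) => PushoutI.of (φ := fun _ : ι => base.comp twist) i (val (some p))
  | some [] => PushoutI.base _ (FreeGroup.of true)
  | none => PushoutI.base _ (FreeGroup.of false)

theorem graft_injective (i : ι) : Function.Injective (graft i) := by
  rintro (_ | p) (_ | q) <;> simp [graft]

theorem branchVal_comp_graft {base : FreeGroup Bool →* G} {val : Option (List ι) → G}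
    (h0 : val none = base (FreeGroup.of false)) (i : ι) : branchVal base val ∘ graft i = val := by
  funext c
  cases c <;> simp [branchVal, graft, h0, twist]

theorem lift_branchVal_comp_subst [DecidableEq ι] {base : FreeGroup Bool →* G}
    {val : Option (List ι) → G} (h1 : val (some []) = base (FreeGroup.of true))
    (i : ι) : (FreeGroup.lift (branchVal base val)).comp (subst (some [i]) none (some [])) =
      FreeGroup.lift (branchVal base val) := by
  ext c
  rw [MonoidHom.comp_apply, subst, FreeGroup.lift_apply_of, FreeGroup.lift_apply_of]
  split_ifs with hc
  · rw [map_mk_uWord]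
    simp [hc, branchVal, h1, twist, map_mk_uWord]
  · simp

theorem lift_mk_eq_prod {α : Type} (f : α → G) (W : Word α) :
    FreeGroup.lift f (FreeGroup.mk W) = (W.map fun q => bif q.2 then f q.1 else (f q.1)⁻¹).prod :=
  FreeGroup.lift_mk

theorem branchVal_of_branch_eq_none (base : FreeGroup Bool →* G) (val : Option (List ι) → G)
    {c : Option (List ι)} (hc : branch c = none) :
    ∃ b, c = rootLetter ι b ∧ branchVal base val c = base (twist (FreeGroup.of b)) ∧
      amalgamVal base val c = PushoutI.base _ (FreeGroup.of b) := by
  rcases c with _ | _ | ⟨i, p⟩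
  · exact ⟨false, rfl, rfl, rfl⟩
  · exact ⟨true, rfl, rfl, rfl⟩
  · simp [branch] at hc

theorem exists_block_of_amalgamVal {base : FreeGroup Bool →* G} {val : Option (List ι) → G}
    (hbase : Function.Injective base) {W : Word (Option (List ι))}
    (hW : FreeGroup.lift (amalgamVal base val) (FreeGroup.mk W) ∈
      (PushoutI.base fun _ : ι => base.comp twist).range) (hne : ∃ q ∈ W, branch q.1 ≠ none) :
    ∃ i h, ∃ g : FreeGroup Bool, h <:+: W ∧ h ≠ [] ∧ (∀ q ∈ h.getLast?, branch q.1 = some i) ∧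
      (∀ q ∈ h, branch q.1 = none ∨ branch q.1 = some i) ∧
      FreeGroup.lift (branchVal base val) (FreeGroup.mk h) = base (twist g) := by
  rw [lift_mk_eq_prod] at hW
  let bv : Option (List ι) × Bool → FreeGroup Bool := fun q =>
    bif q.2 then FreeGroup.of (q.1.isSome) else (FreeGroup.of (q.1.isSome))⁻¹
  obtain ⟨i, h, hh, h1, h2, h3, g, hg⟩ := exists_block_of_mem_range_base
    (φ := fun _ : ι => base.comp twist) (fun _ => hbase.comp twist_injective)
    (tag := fun q : Option (List ι) × Bool => branch q.1) (bv := bv)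
    (gv := fun _ q => bif q.2 then branchVal base val q.1 else (branchVal base val q.1)⁻¹)
    (by
      rintro ⟨c, e⟩ i hc
      obtain ⟨b, rfl, hb, -⟩ := branchVal_of_branch_eq_none base val hc
      cases e <;> cases b <;> simp_all [bv, rootLetter])
    (by
      rintro ⟨c, e⟩ hc
      obtain ⟨b, rfl, -, hb⟩ := branchVal_of_branch_eq_none base val hc
      cases e <;> cases b <;> simp_all [bv, rootLetter])
    (by
      rintro ⟨c, e⟩ i hc
      rcases c with _ | _ | ⟨j, p⟩
      · simp [branch] at hc
      · simp [branch] at hc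
      · obtain rfl : j = i := by simpa [branch] using hc
        cases e <;> simp [amalgamVal, branchVal]) hW hne
  refine ⟨i, h, g, hh, ?_, ?_, h3, ?_⟩
  · rintro rfl
    simp at h1
  · intro q hq
    obtain ⟨b, hb, hb'⟩ := h2
    rwa [Option.mem_unique hq hb]
  · rw [lift_mk_eq_prod, ← hg]
    rfl

/-- A block with value in the base group gives a shorter word on the subtree with trivial value. -/
theorem exists_word_of_block [DecidableEq ι] {T d : ℕ} (hT : T ≤ 2998)
    {base : FreeGroup Bool →* G} {val : Option (List ι) → G}
    (h0 : val none = base (FreeGroup.of false)) (h1 : val (some []) = base (FreeGroup.of true))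
    {i : ι} {h : Word (Option (List ι))} {g : FreeGroup Bool} (hred : IsReduced h) (hne : h ≠ [])
    (hlast : ∀ q ∈ h.getLast?, branch q.1 = some i)
    (hbr : ∀ q ∈ h, branch q.1 = none ∨ branch q.1 = some i)
    (hd : ∀ q ∈ h, ∀ p, q.1 = some p → p.length ≤ d + 1) (hgood : GoodTree T h)
    (hg : FreeGroup.lift (branchVal base val) (FreeGroup.mk h) = base (twist g)) :
    ∃ W, W ≠ [] ∧ IsReduced W ∧ (∀ q ∈ W, ∀ p, q.1 = some p → p.length ≤ d) ∧ GoodTree T W ∧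
      FreeGroup.lift val (FreeGroup.mk W) = 1 := by
  set w : Word (Option (List ι)) := (invRev g.toWord).map fun p => (rootLetter ι p.1, p.2) with hw
  have hwroot : ∀ q ∈ w, q.1 = none ∨ q.1 = some [] := by
    intro q hq
    obtain ⟨p, -, rfl⟩ := List.mem_map.1 hq
    exact rootLetter_eq p.1
  have hwred : IsReduced w :=
    isReduced_map rootLetter_injective (isReduced_invRev FreeGroup.isReduced_toWord)
  have hvroot : branchVal base val ∘ rootLetter ι = fun c => base (twist (FreeGroup.of c)) := by
    funext c
    cases c <;> rfl
  have hwval : FreeGroup.lift (branchVal base val) (FreeGroup.mk w) = base (twist g⁻¹) := by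
    rw [hw, lift_map, hvroot, ← FreeGroup.inv_mk, FreeGroup.mk_toWord]
    exact DFunLike.congr_fun (f := FreeGroup.lift fun c => base (twist (FreeGroup.of c)))
      (g := base.comp twist) (by ext c; simp) g⁻¹
  have hW1red : IsReduced (h ++ w) := by
    refine isReduced_append_of_disjoint hred hwred fun p hp q hq e => ?_
    have := hlast p hp
    rcases hwroot q hq with h | h <;> rw [e, h] at this <;> simp [branch] at this
  have hW1val : FreeGroup.lift (branchVal base val) (FreeGroup.mk (h ++ w)) = 1 := by
    rw [mk_append, map_mul, hg, hwval, ← map_mul, ← map_mul]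
    simp
  have hW1root : Good 3000 (some [i]) none (some []) (h ++ w) := by
    refine Good.mono ((by simpa using hgood [] i : Good (T + 1) _ _ _ h).append
      (good_one_of_forall_ne (by simp) (by simp) fun p hp e => ?_)) (by omega)
    rcases hwroot p hp with h | h <;> rw [e] at h <;> simp at h
  have hW1good : ∀ p j, Good T (some (i :: p ++ [j])) none (some (i :: p)) (h ++ w) := by
    intro p j
    refine (by simpa using hgood (i :: p) j : Good T _ _ _ h).append
      (T' := 0) (good_zero_of_forall_ne fun q hq => ?_)
    rcases hwroot q hq with h | h <;> rw [h] <;> simp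
  obtain ⟨R, hR, hRs, hRne, htr⟩ := exists_subst (by simp) (by simp) hW1red hW1root
  have hRletter : ∀ q ∈ R, ∃ c, graft i c = q.1 ∧ ∀ p, c = some p → p.length ≤ d := by
    intro q hq
    rcases htr.mem hq with e | e | ⟨hqW, e⟩
    · exact ⟨some [], by simp [graft, e], by simp⟩
    · exact ⟨none, by simp [graft, e], by simp⟩
    · rcases List.mem_append.1 hqW with hq | hq
      · rcases q with ⟨_ | _ | ⟨j, p⟩, s⟩
        · exact ⟨none, rfl, by simp⟩
        · simp at e
        · obtain rfl : j = i := by simpa [branch] using hbr _ hq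
          exact ⟨some p, rfl, by simpa using hd _ hq _ rfl⟩
      · rcases hwroot q hq with h | h
        · exact ⟨none, by simp [graft, h], by simp⟩
        · exact absurd h e
  obtain ⟨W, rfl⟩ := exists_map_eq (graft i) (W := R) fun q hq =>
    (hRletter q hq).imp fun _ h => h.1
  refine ⟨W, ?_, isReduced_of_map _ hR, ?_, ?_, ?_⟩
  · rintro rfl
    exact hRne (by simp [hne]) rfl
  · intro q hq p hp
    obtain ⟨c, hc, hcd⟩ := hRletter _ (List.mem_map.2 ⟨q, hq, rfl⟩)
    exact hcd p ((graft_injective i hc).trans hp)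
  · intro p j v hv ha
    have hv' := hv.map fun p => (graft i p.1, p.2)
    have ha' := ha.map (graft i)
    have hocc : occ (some [i]) (v.map fun p => (graft i p.1, p.2)) ≤ if p = [] then 1 else 0 := by
      split_ifs with hp
      · subst hp
        refine (ha'.occ_le _).trans (occ_arc_last ?_ ?_).le <;> simp [graft]
      · refine (occ_eq_zero fun q hq e => ?_).le
        rcases ha'.mem hq with h | h | h <;> rw [e] at h <;> simp [graft, hp] at h
    obtain ⟨l, m, r, e, hl, hr, hm, -⟩ := htr _ hv' (hocc.trans (by split_ifs <;> simp))
    have hcnt : ∀ l : Word (Option (List ι)), (∀ q ∈ l, q.1 = some [i] ∨ q.1 = none) →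
        cnt none l ≤ occ (some [i]) l := by
      intro l hl
      refine List.countP_mono_left fun q hq h => ?_
      rcases hl q hq with e | e <;> simp_all
    have h2 := hW1good p j m hm (ha'.of_isInfix (by rw [e]; exact ⟨l, r, rfl⟩))
    have h3 : cnt (graft i none) (v.map fun p => (graft i p.1, p.2)) = cnt none v :=
      cnt_map (fun c h => graft_injective i h) v
    have h4 := hcnt l hl
    have h5 := hcnt r hr
    rw [e] at h3 hocc
    simp only [graft, cnt_append, occ_append] at h3 hocc
    split_ifs at hocc ⊢ <;> omega
  · rw [← branchVal_comp_graft h0 i, ← lift_map, hRs, ← MonoidHom.comp_apply,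
      lift_branchVal_comp_subst h1, hW1val]

theorem IsTreeOfRoots.amalgam [DecidableEq ι] {d : ℕ} {base : FreeGroup Bool →* G}
    {val : Option (List ι) → G} (h : IsTreeOfRoots d base val) :
    IsTreeOfRoots (d + 1) (PushoutI.base fun _ : ι => base.comp twist) (amalgamVal base val) where
  injective := PushoutI.base_injective fun _ => h.injective.comp twist_injective
  val_none := rfl
  val_root := rfl
  val_parent := by
    have key : ∀ i, amalgamVal base val none =
        PushoutI.of (φ := fun _ : ι => base.comp twist) i (val none) := by
      intro i
      rw [h.val_none]
      refine (PushoutI.of_apply_eq_base _ i _).symm.trans (congrArg _ ?_)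
      simp [twist]
    have hmap : ∀ i c, evalU (PushoutI.of (φ := fun _ : ι => base.comp twist) i c)
        (amalgamVal base val none) = PushoutI.of i (evalU c (val none)) := by
      intro i c
      rw [key i, map_evalU]
    rintro (_ | ⟨k, p⟩) i hp
    · refine Eq.trans ?_ (hmap i (val (some []))).symm
      rw [h.val_root, h.val_none, ← map_mk_uWord]
      refine (PushoutI.of_apply_eq_base _ i _).symm.trans (congrArg _ ?_)
      simp [twist]
    · refine Eq.trans ?_ (hmap k (val (some (p ++ [i])))).symm
      rw [← h.val_parent p i (by simpa using hp)]
      rfl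
  mem_root := by
    intro T W hT hW hd hgood hval
    by_contra! hcon
    obtain ⟨q, hq, hq0, hq1⟩ := hcon
    obtain ⟨i, h', g, hh, hne, hlast, hbr, hg⟩ := exists_block_of_amalgamVal h.injective hval
      ⟨q, hq, by rcases q with ⟨_ | _ | ⟨j, p⟩, s⟩ <;> simp_all [branch]⟩
    obtain ⟨W', hW', hred, hd', hgood', hval'⟩ := exists_word_of_block hT h.val_none h.val_root
      (hW.of_isInfix hh) hne hlast hbr (fun q hq => hd q (hh.subset hq))
      (fun p i => (hgood p i).of_isInfix hh) hg
    exact hW' (h.eq_nil hT hred hd' hgood' hval')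

theorem exists_isTreeOfRoots (ι : Type) [DecidableEq ι] (d : ℕ) :
    ∃ (G : Type) (_ : Group G) (base : FreeGroup Bool →* G) (val : Option (List ι) → G),
      IsTreeOfRoots d base val := by
  induction d with
  | zero =>
    refine ⟨FreeGroup Bool, inferInstance, MonoidHom.id _, fun c => FreeGroup.of c.isSome,
      Function.injective_id, rfl, rfl, by simp, ?_⟩
    rintro T W - - hd - - ⟨_ | p, s⟩ hq
    · simp
    · simpa using hd _ hq p rfl
  | succ d ih =>
    obtain ⟨G, _, base, val, h⟩ := ih
    exact ⟨_, _, _, _, h.amalgam⟩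

end Tower

section Pullback

variable {α β : Type} {f : α → β}

theorem OnArc.of_map (hf : Function.Injective f) {x y z : α} {v : Word α}
    (h : OnArc (f x) (f y) (f z) (v.map fun p => (f p.1, p.2))) : OnArc x y z v := by
  have hf' : Function.Injective fun p : α × Bool => (f p.1, p.2) := fun p q e =>
    Prod.ext (hf (Prod.mk.inj e).1) (Prod.mk.inj e).2
  have e : (arc x y z).map (fun p => (f p.1, p.2)) = arc (f x) (f y) (f z) := by
    simp [arc, map_uWord]
  have key : ∀ v : Word α, v.map (fun p => (f p.1, p.2)) <:+: arc (f x) (f y) (f z) →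
      v <:+: arc x y z := by
    rintro v ⟨s, t, h⟩
    rw [← e, eq_comm, List.map_eq_append_iff] at h
    obtain ⟨l, t', hlt, hl, -⟩ := h
    obtain ⟨s', v', rfl, -, hv⟩ := List.map_eq_append_iff.1 hl
    rw [List.map_injective_iff.2 hf' hv] at hlt
    exact ⟨s', t', hlt.symm⟩
  rw [OnArc, ← map_invRev] at h
  exact h.imp (key v) (key _)

variable [DecidableEq α] [DecidableEq β]

theorem Good.map (hf : Function.Injective f) {T : ℕ} {x y z : α} {W : Word α}
    (h : Good T x y z W) : Good T (f x) (f y) (f z) (W.map fun p => (f p.1, p.2)) := by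
  rintro v ⟨s, t, hst⟩ ha
  rw [eq_comm, List.map_eq_append_iff] at hst
  obtain ⟨l, t', hlt, hl, -⟩ := hst
  obtain ⟨s', v', rfl, -, rfl⟩ := List.map_eq_append_iff.1 hl
  rw [cnt_map fun c e => hf e]
  exact h v' ⟨s', t', hlt.symm⟩ (ha.of_map hf)

theorem Good.of_map (hf : Function.Injective f) {T : ℕ} {x y z : α} {W : Word α}
    (h : Good T (f x) (f y) (f z) (W.map fun p => (f p.1, p.2))) : Good T x y z W := by
  intro v hv ha
  rw [← cnt_map (f := f) fun c e => hf e]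
  exact h _ (hv.map _) (ha.map f)

end Pullback

section Presentation

/-- The vertex `v` as a generator of `K`. -/
def vtx (v : ℕ × List ℤ) : KGen := KGen.vert v.1 v.2

/-- The generators `a` and `bᵢ` of `K`. -/
def edge : Option ℤ → KGen
  | none => KGen.a
  | some i => KGen.b i

/-- The vertex equal to `u(v, y)` in `K`. -/
def move : Option ℤ → ℕ × List ℤ → ℕ × List ℤ
  | none, v => parent v.1 v.2
  | some i, v => (v.1, v.2 ++ [i])

theorem mem_KRelWords_iff {r : Word KGen} :
    r ∈ KRelWords ↔ ∃ y v, r = uWord (vtx v) (edge y) ++ [(vtx (move y v), false)] := by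
  constructor
  · rintro (⟨n, τ, rfl⟩ | ⟨n, τ, i, rfl⟩)
    · exact ⟨none, (n, τ), rfl⟩
    · exact ⟨some i, (n, τ), rfl⟩
  · rintro ⟨_ | i, v, rfl⟩
    · exact .inl ⟨v.1, v.2, rfl⟩
    · exact .inr ⟨v.1, v.2, i, rfl⟩

theorem vtx_injective : Function.Injective vtx := by
  rintro ⟨n, τ⟩ ⟨m, σ⟩ h
  simpa [vtx] using h

theorem vtx_ne_edge (v : ℕ × List ℤ) (y : Option ℤ) : vtx v ≠ edge y := by
  cases y <;> simp [vtx, edge]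

theorem exists_eq_vtx_or_edge (c : KGen) : (∃ v, c = vtx v) ∨ ∃ y, c = edge y := by
  cases c with
  | vert n τ => exact .inl ⟨(n, τ), rfl⟩
  | a => exact .inr ⟨none, rfl⟩
  | b i => exact .inr ⟨some i, rfl⟩

theorem move_concat (n : ℕ) (τ : List ℤ) (i : ℤ) : move none (n, τ ++ [i]) = (n, τ) := by
  cases τ with
  | nil => rfl
  | cons j τ => exact Prod.ext rfl (List.dropLast_concat (l₁ := j :: τ))

theorem move_ne (y : Option ℤ) (v : ℕ × List ℤ) : move y v ≠ v := by
  rcases v with ⟨n, τ⟩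
  cases y with
  | none =>
    rcases List.eq_nil_or_concat τ with rfl | ⟨σ, i, rfl⟩
    · simp [move, parent]
    · rw [List.concat_eq_append, move_concat]
      simp
  | some i => simp [move]

/-- The vertices whose two coordinates are of size less than `N`. -/
def small (N : ℕ) (v : ℕ × List ℤ) : Prop := v.1 < N ∧ v.2.length < N

theorem small.mono {N M : ℕ} {v : ℕ × List ℤ} (h : small N v) (hNM : N ≤ M) : small M v :=
  ⟨h.1.trans_le hNM, h.2.trans_le hNM⟩

/-- An element which is trivial in `K` is already trivial modulo the relators at small vertices. -/
theorem exists_small_of_eq_one {g : FreeGroup KGen} (hg : g ∈ Subgroup.normalClosure KRels) :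
    ∃ N, ∀ (M : ℕ) (G : Type) [Group G] (f : FreeGroup KGen →* G), N ≤ M →
      (∀ y v, small M v → f (FreeGroup.mk (uWord (vtx v) (edge y))) =
        f (FreeGroup.of (vtx (move y v)))) → f g = 1 := by
  induction hg using Subgroup.closure_induction with
  | mem g hg =>
    obtain ⟨r, ⟨w, hw, rfl⟩, hr⟩ := Group.mem_conjugatesOfSet_iff.1 hg
    obtain ⟨c, rfl⟩ := isConj_iff.1 hr
    obtain ⟨y, v, rfl⟩ := mem_KRelWords_iff.1 hw
    refine ⟨max v.1 v.2.length + 1, fun M G _ f hM hf => ?_⟩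
    have h := hf y v ⟨by omega, by omega⟩
    have h2 : FreeGroup.mk [(vtx (move y v), false)] = (FreeGroup.of (vtx (move y v)))⁻¹ := rfl
    rw [mk_append, h2]
    simp [h]
  | one => exact ⟨0, by simp⟩
  | mul g h _ _ ihg ihh =>
    obtain ⟨N, hN⟩ := ihg
    obtain ⟨N', hN'⟩ := ihh
    refine ⟨max N N', fun M G _ f hM hf => ?_⟩
    rw [map_mul, hN M G f (by omega) hf, hN' M G f (by omega) hf, one_mul]
  | inv g _ ih =>
    obtain ⟨N, hN⟩ := ih
    refine ⟨N, fun M G _ f hM hf => ?_⟩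
    rw [map_inv, hN M G f hM hf, inv_one]

theorem exists_forall_small (W : Word KGen) : ∃ N, ∀ q ∈ W, ∀ v, q.1 = vtx v → small N v := by
  induction W with
  | nil => exact ⟨0, by simp⟩
  | cons p W ih =>
    obtain ⟨N, hN⟩ := ih
    rcases exists_eq_vtx_or_edge p.1 with ⟨w, hw⟩ | ⟨y, hy⟩
    · refine ⟨N + w.1 + w.2.length + 1, fun q hq v hv => ?_⟩
      rcases List.mem_cons.1 hq with rfl | hq
      · obtain rfl := vtx_injective (hw.symm.trans hv)
        exact ⟨by omega, by omega⟩
      · exact (hN q hq v hv).mono (by omega)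
    · refine ⟨N, fun q hq v hv => ?_⟩
      rcases List.mem_cons.1 hq with rfl | hq
      · exact absurd (hv.symm.trans hy) (vtx_ne_edge _ _)
      · exact hN q hq v hv

end Presentation

section Code

/-- The labels of the edges of the trees encoding the action of a single generator. -/
abbrev Label := (ℕ × List ℤ) ⊕ Option ℤ

/-- The position of the vertex `v` in the tree attached to the generator `y`. -/
def code (N : ℕ) : Option ℤ → ℕ × List ℤ → List Label
  | none, v => if v.2.length ≤ N then .inl (max v.1 N, []) ::
      (List.replicate (N - v.1) (.inr none) ++ v.2.map (.inr ∘ some)) else [.inl v]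
  | some i, v => .inl (v.1, v.2 ++ List.replicate (N - v.2.length) i) ::
      List.replicate (N - v.2.length) (.inr none)

theorem length_code_le (N : ℕ) (y : Option ℤ) (v : ℕ × List ℤ) :
    (code N y v).length ≤ 2 * N + 1 := by
  cases y with
  | none =>
    rw [code]
    split_ifs
    · simp
      omega
    · simp
  | some i =>
    simp [code]
    omega

theorem code_injective (N : ℕ) (y : Option ℤ) : Function.Injective (code N y) := by
  rintro ⟨n, τ⟩ ⟨m, σ⟩ h
  cases y with
  | none =>
    simp only [code] at h
    split_ifs at h with h1 h2 h2
    · simp only [List.cons.injEq, Sum.inl.injEq, Prod.mk.injEq, and_true] at h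
      obtain ⟨ha, hb⟩ := h
      have hc := congrArg (List.countP fun c : Label => c = .inr none) hb
      have hz : ∀ τ : List ℤ,
          (τ.map (.inr ∘ some)).countP (fun c : Label => c = .inr none) = 0 := by
        simp [List.countP_map, List.countP_eq_zero]
      simp only [List.countP_append, hz, List.countP_replicate, decide_true, if_true] at hc
      obtain rfl : n = m := by omega
      rw [List.append_cancel_left_eq] at hb
      rw [List.map_injective_iff.2 (Sum.inr_injective.comp (Option.some_injective _)) hb]
    · simp only [List.cons.injEq, Sum.inl.injEq, Prod.mk.injEq] at h
      obtain ⟨⟨-, rfl⟩, -⟩ := h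
      simp at h2
    · simp only [List.cons.injEq, Sum.inl.injEq, Prod.mk.injEq] at h
      obtain ⟨⟨-, rfl⟩, -⟩ := h
      simp at h1
    · simpa using h
  | some i =>
    simp only [code, List.cons.injEq, Sum.inl.injEq, Prod.mk.injEq] at h
    obtain ⟨⟨rfl, ha⟩, hb⟩ := h
    have hc := congrArg List.length hb
    rw [List.length_replicate, List.length_replicate] at hc
    rw [hc] at ha
    rw [List.append_cancel_right ha]

theorem code_eq_code_move {N : ℕ} {v : ℕ × List ℤ} (hv : small N v) (y : Option ℤ) :
    ∃ i, code N y v = code N y (move y v) ++ [i] := by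
  obtain ⟨n, τ⟩ := v
  obtain ⟨h1, h2⟩ := hv
  cases y with
  | none =>
    rcases List.eq_nil_or_concat τ with rfl | ⟨σ, j, rfl⟩
    · refine ⟨.inr none, ?_⟩
      have : N - n = N - (n + 1) + 1 := by simp at h1; omega
      have h3 : max n N = max (n + 1) N := by simp at h1; omega
      simp [code, move, parent, this, h3, List.replicate_succ']
    · refine ⟨.inr (some j), ?_⟩
      simp only [List.concat_eq_append, List.length_append, List.length_singleton] at h2 ⊢
      rw [move_concat]
      simp [code, show σ.length ≤ N by omega, show σ.length + 1 ≤ N by omega]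
  | some i =>
    refine ⟨.inr none, ?_⟩
    have : N - τ.length = N - (τ.length + 1) + 1 := by simp at h2; omega
    simp [code, move, this, List.replicate_succ', ← List.replicate_succ]

end Code

section Amalgam

variable {G : Type} [Group G] {base : FreeGroup Bool →* G} {val : Option (List Label) → G} {N : ℕ}

/-- The free group on the vertices inside the group of the generator `y`. -/
def vtxHom (val : Option (List Label) → G) (N : ℕ) (y : Option ℤ) :
    FreeGroup (ℕ × List ℤ) →* G :=
  FreeGroup.lift fun v => val (some (code N y v))

theorem lift_code (y : Option ℤ) (w : Word (ℕ × List ℤ)) :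
    FreeGroup.lift val (FreeGroup.mk (w.map fun p => (some (code N y p.1), p.2))) =
      vtxHom val N y (FreeGroup.mk w) := by
  exact lift_map val (fun v => some (code N y v)) w

theorem vtxHom_injective (h : IsTreeOfRoots (2 * N + 1) base val) (y : Option ℤ) :
    Function.Injective (vtxHom val N y) := by
  rw [injective_iff_map_eq_one]
  intro g hg
  rw [← FreeGroup.mk_toWord (x := g), ← lift_code] at hg
  have hW : IsReduced (g.toWord.map fun p => (some (code N y p.1), p.2)) :=
    isReduced_map (f := fun v => some (code N y v))
      ((Option.some_injective _).comp (code_injective N y)) FreeGroup.isReduced_toWord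
  have := h.eq_nil (T := 202) (by simp) hW ?_ ?_ hg
  · simpa using this
  · intro q hq p hp
    obtain ⟨r, -, rfl⟩ := List.mem_map.1 hq
    rw [← Option.some_inj.1 hp]
    exact length_code_le N y r.1
  · intro p i
    refine (good_of_forall_ne_right fun q hq => ?_).mono (by split_ifs <;> simp)
    obtain ⟨r, -, rfl⟩ := List.mem_map.1 hq
    simp

/-- The generator of `K` attached to a letter `none` for the edge `y` or `some v` for a vertex. -/
def letter (y : Option ℤ) : Option (ℕ × List ℤ) → KGen
  | none => edge y
  | some v => vtx v

theorem letter_injective (y : Option ℤ) : Function.Injective (letter y) := by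
  rintro (_ | v) (_ | w) h
  · rfl
  · exact absurd h.symm (vtx_ne_edge w y)
  · exact absurd h (vtx_ne_edge v y)
  · exact congrArg some (vtx_injective h)

/-- The kind of a generator of `K`. -/
def kind : KGen → Option (Option ℤ)
  | .vert _ _ => none
  | .a => some none
  | .b i => some (some i)

theorem kind_eq_none {c : KGen} (h : kind c = none) : ∃ v, c = vtx v := by
  cases c with
  | vert n τ => exact ⟨(n, τ), rfl⟩
  | a => simp [kind] at h
  | b i => simp [kind] at h

theorem kind_eq_some {c : KGen} {y : Option ℤ} (h : kind c = some y) : c = edge y := by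
  cases c with
  | vert n τ => simp [kind] at h
  | a => rw [← Option.some_inj.1 h]; rfl
  | b i => rw [← Option.some_inj.1 h]; rfl

/-- The value of a generator of `K` in the group of the generator `y`. -/
def edgeVal (val : Option (List Label) → G) (N : ℕ) (y : Option ℤ) : KGen → G
  | .vert n τ => val (some (code N y (n, τ)))
  | _ => val none

/-- The value of a generator of `K` in the amalgam over the free group on the vertices. -/
def genVal (val : Option (List Label) → G) (N : ℕ) : KGen → PushoutI (vtxHom val N)
  | .vert n τ => PushoutI.base _ (FreeGroup.of (n, τ))
  | .a => PushoutI.of (φ := vtxHom val N) none (val none)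
  | .b i => PushoutI.of (φ := vtxHom val N) (some i) (val none)

theorem genVal_vtx (v : ℕ × List ℤ) (y : Option ℤ) : genVal val N (vtx v) =
    PushoutI.of (φ := vtxHom val N) y (val (some (code N y v))) := by
  refine (PushoutI.of_apply_eq_base (vtxHom val N) y (FreeGroup.of v)).symm.trans ?_
  simp [vtxHom]

theorem genVal_edge (y : Option ℤ) :
    genVal val N (edge y) = PushoutI.of (φ := vtxHom val N) y (val none) := by
  cases y <;> rfl

theorem lift_genVal_relator (h : IsTreeOfRoots (2 * N + 1) base val) (y : Option ℤ)
    {v : ℕ × List ℤ} (hv : small N v) :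
    FreeGroup.lift (genVal val N) (FreeGroup.mk (uWord (vtx v) (edge y))) =
      FreeGroup.lift (genVal val N) (FreeGroup.of (vtx (move y v))) := by
  obtain ⟨i, hi⟩ := code_eq_code_move hv y
  have hd : (code N y (move y v)).length < 2 * N + 1 := by
    have := length_code_le N y v
    rw [hi] at this
    simpa using this
  rw [map_mk_uWord]
  simp only [FreeGroup.lift_apply_of]
  rw [genVal_vtx v y, genVal_vtx (move y v) y, genVal_edge, ← map_evalU, hi,
    ← h.val_parent _ _ hd]

theorem exists_block_of_genVal (h : IsTreeOfRoots (2 * N + 1) base val) {W : Word KGen}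
    (hW : FreeGroup.lift (genVal val N) (FreeGroup.mk W) = 1)
    (hne : ∃ q ∈ W, kind q.1 ≠ none) :
    ∃ y, ∃ w : Word (Option (ℕ × List ℤ)), ∃ g, w.map (fun p => (letter y p.1, p.2)) <:+: W ∧
      w ≠ [] ∧ (∀ q ∈ w.getLast?, q.1 = none) ∧
      FreeGroup.lift (fun c => val (c.map (code N y))) (FreeGroup.mk w) = vtxHom val N y g := by
  rw [lift_mk_eq_prod] at hW
  let bv : KGen × Bool → FreeGroup (ℕ × List ℤ)
    | (.vert n τ, true) => FreeGroup.of (n, τ)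
    | (.vert n τ, false) => (FreeGroup.of (n, τ))⁻¹
    | _ => 1
  obtain ⟨y, h, hh, h1, h2, h3, g, hg⟩ := exists_block_of_mem_range_base
    (φ := vtxHom val N) (fun y => vtxHom_injective h y)
    (tag := fun q : KGen × Bool => kind q.1) (bv := bv)
    (gv := fun y q => bif q.2 then edgeVal val N y q.1 else (edgeVal val N y q.1)⁻¹)
    (by
      rintro ⟨c, e⟩ y hc
      obtain ⟨v, rfl⟩ := kind_eq_none hc
      cases e <;> simp [bv, vtx, vtxHom, edgeVal])
    (by
      rintro ⟨c, e⟩ hc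
      obtain ⟨v, rfl⟩ := kind_eq_none hc
      cases e <;> simp [bv, vtx, genVal])
    (by
      rintro ⟨c, e⟩ y hc
      obtain rfl := kind_eq_some hc
      cases y <;> cases e <;> simp [edge, edgeVal, genVal]) (hW ▸ one_mem _) hne
  have hletter : ∀ q ∈ h, ∃ c, letter y c = q.1 := by
    intro q hq
    rcases h3 q hq with e | e
    · obtain ⟨v, hv⟩ := kind_eq_none e
      exact ⟨some v, hv.symm⟩
    · exact ⟨none, (kind_eq_some e).symm⟩
  obtain ⟨w, rfl⟩ := exists_map_eq (letter y) hletter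
  refine ⟨y, w, g, hh, ?_, ?_, ?_⟩
  · rintro rfl
    simp at h1
  · intro q hq
    obtain ⟨b, hb, hb'⟩ := h2
    rw [List.getLast?_map, Option.mem_def, Option.mem_def.1 hq, Option.map_some,
      Option.some_inj] at hb
    rw [← hb] at hb'
    exact letter_injective y (kind_eq_some hb')
  · rw [hg, List.map_map, lift_mk_eq_prod]
    refine congrArg List.prod (List.map_congr_left fun q _ => ?_)
    rcases q with ⟨_ | v, e⟩
    · cases y <;> cases e <;> rfl
    · cases e <;> rfl

theorem eq_nil_of_lift_genVal_eq_one (h : IsTreeOfRoots (2 * N + 1) base val) {W : Word KGen}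
    (hred : IsReduced W) (hsmall : ∀ q ∈ W, ∀ v, q.1 = vtx v → small N v)
    (hgood : ∀ y v, Good 2576 (vtx v) (edge y) (vtx (move y v)) W)
    (hW : FreeGroup.lift (genVal val N) (FreeGroup.mk W) = 1) : W = [] := by
  by_cases hne : ∃ q ∈ W, kind q.1 ≠ none
  · obtain ⟨y, w, g, hw, hwne, hlast, hg⟩ := exists_block_of_genVal h hW hne
    exfalso
    set s : Word (Option (ℕ × List ℤ)) := (invRev g.toWord).map fun p => (some p.1, p.2) with hs
    have hsnone : ∀ q ∈ s, q.1 ≠ none := by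
      intro q hq
      obtain ⟨p, -, rfl⟩ := List.mem_map.1 hq
      simp
    have hwsred : IsReduced (w ++ s) := by
      refine isReduced_append_of_disjoint (isReduced_of_map _ (hred.of_isInfix hw))
        (isReduced_map (Option.some_injective _) (isReduced_invRev FreeGroup.isReduced_toWord))
        fun p hp q hq e => hsnone q hq ?_
      rw [← e, hlast p hp]
    have hcode : Function.Injective (Option.map (code N y)) :=
      Option.map_injective (code_injective N y)
    have hsval : FreeGroup.lift (val ∘ Option.map (code N y)) (FreeGroup.mk s) =
        vtxHom val N y g⁻¹ := by
      rw [hs, lift_map, ← FreeGroup.inv_mk, FreeGroup.mk_toWord]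
      rfl
    have hval : FreeGroup.lift val (FreeGroup.mk
        ((w ++ s).map fun p => (p.1.map (code N y), p.2))) = 1 := by
      rw [lift_map, mk_append, map_mul, hsval]
      erw [hg]
      rw [← map_mul, mul_inv_cancel, map_one]
    have hnil := h.eq_nil (T := 2778) (by simp) (isReduced_map hcode hwsred) ?_ ?_ hval
    · simp [hwne] at hnil
    · intro q hq p hp
      obtain ⟨⟨_ | v, e⟩, -, rfl⟩ := List.mem_map.1 hq
      · simp at hp
      · rw [← Option.some_inj.1 hp]
        exact length_code_le N y v
    · intro p i
      rw [List.map_append]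
      refine Good.mono (T := 2576 + 202) (Good.append ?_ (good_of_forall_ne_right fun q hq => ?_))
        (by split_ifs <;> simp)
      · by_cases hx : ∃ q ∈ w, q.1.map (code N y) = some (p ++ [i])
        · obtain ⟨⟨_ | v, e⟩, hq, hx⟩ := hx
          · simp at hx
          · have hv := hsmall _ (hw.subset (List.mem_map.2 ⟨_, hq, rfl⟩)) v rfl
            obtain ⟨j, hj⟩ := code_eq_code_move hv y
            obtain ⟨rfl, rfl⟩ : p = code N y (move y v) ∧ i = j := by
              simpa [hj, eq_comm] using hx
            rw [← hj]
            exact (((hgood y v).of_isInfix hw).of_map (letter_injective y) (x := some v) (y := none)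
              (z := some (move y v))).map hcode
        · refine (good_one_of_forall_ne (by simp) (by simp) fun q hq e => hx ?_).mono (by simp)
          obtain ⟨r, hr, rfl⟩ := List.mem_map.1 hq
          exact ⟨r, hr, e⟩
      · obtain ⟨r, hr, rfl⟩ := List.mem_map.1 hq
        simpa using hsnone r hr
  · push Not at hne
    obtain ⟨w, rfl⟩ := exists_map_eq vtx (W := W) fun q hq => by
      obtain ⟨v, hv⟩ := kind_eq_none (hne q hq)
      exact ⟨v, hv.symm⟩
    rw [lift_map] at hW
    have hb : FreeGroup.lift (genVal val N ∘ vtx) = PushoutI.base (vtxHom val N) := by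
      ext v
      simp [genVal, vtx]
    rw [hb] at hW
    rw [eq_nil_of_mk_eq_one (isReduced_of_map _ hred)
      (PushoutI.base_injective (fun y => vtxHom_injective h y) (hW.trans (map_one _).symm))]
    rfl

/-- A reduced word over the generators of `K` which only contains small parts of relators and is
trivial in `K` is empty. -/
theorem eq_nil_of_mem_normalClosure {W : Word KGen} (hred : IsReduced W)
    (hgood : ∀ y v, Good 2576 (vtx v) (edge y) (vtx (move y v)) W)
    (hW : FreeGroup.mk W ∈ Subgroup.normalClosure KRels) : W = [] := by
  obtain ⟨N, hN⟩ := exists_small_of_eq_one hW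
  obtain ⟨N', hN'⟩ := exists_forall_small W
  obtain ⟨G, _, base, val, h⟩ := exists_isTreeOfRoots Label (2 * max N N' + 1)
  exact eq_nil_of_lift_genVal_eq_one h hred
    (fun q hq v hv => (hN' q hq v hv).mono (le_max_right _ _)) hgood
    (hN _ _ _ (le_max_left _ _) fun y v hv => lift_genVal_relator h y hv)

end Amalgam

section Dehn

theorem isReducedWord_iff {α : Type} [DecidableEq α] {w : Word α} :
    IsReducedWord w ↔ IsReduced w :=
  FreeGroup.isReduced_iff_reduce_eq.symm

theorem isCyclicPermOf_of_isInfix {α : Type} {r v : Word α} (h : v <:+: r ++ r)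
    (hv : v.length ≤ r.length) : ∃ c, IsCyclicPermOf c r ∧ v <:+: c := by
  obtain ⟨s, t, h⟩ := h
  by_cases hs : s.length ≤ r.length
  · refine ⟨r.drop s.length ++ r.take s.length, ⟨_, _, (List.take_append_drop _ _).symm, rfl⟩, ?_⟩
    have h1 : s = r.take s.length := by
      have := congrArg (List.take s.length) h
      simpa [List.take_append_of_le_length hs] using this
    have h2 : v ++ t = r.drop s.length ++ r := by
      have := congrArg (List.drop s.length) h
      simpa [List.drop_append_of_le_length hs] using this
    refine List.IsPrefix.isInfix ?_
    refine List.prefix_of_prefix_length_le (l₃ := r.drop s.length ++ r) ⟨t, h2⟩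
      ?_ (by simp; omega)
    exact ⟨r.drop s.length, by simp⟩
  · refine ⟨r, ⟨[], r, by simp, by simp⟩, ?_⟩
    have h2 : v ++ t = r.drop (s.length - r.length) := by
      have := congrArg (List.drop s.length) h
      rw [List.append_assoc, List.drop_left, List.drop_append,
        List.drop_eq_nil_of_le (by omega)] at this
      simpa using this
    exact (List.prefix_append v t).isInfix.trans (h2 ▸ (List.drop_suffix _ _).isInfix)

theorem mem_symmClosure_of_perm {α : Type} [DecidableEq α] {R : Set (Word α)} {r c : Word α}
    (hr : r ∈ R) (hrr : IsReduced (r ++ r))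
    (hc : IsCyclicPermOf c r ∨ IsCyclicPermOf c (invRev r)) : c ∈ symmClosure R := by
  refine ⟨r, hr, r, ⟨isReducedWord_iff.2 hrr, [], ?_⟩, hc⟩
  have : IsReduced r := hrr.of_isInfix (List.prefix_append r r).isInfix
  simpa [wordInv] using this.reduce_eq

theorem isReduced_relator {α : Type} {x y z : α} (hxz : x ≠ z) (hyz : y ≠ z) :
    IsReduced ((uWord x y ++ [(z, false)]) ++ (uWord x y ++ [(z, false)])) := by
  have hU : ∀ q ∈ uWord x y, q.1 ≠ z := by
    intro q hq
    rcases (mem_uWord hq).1 with h | h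
    · rwa [h]
    · rwa [h]
  have hr : IsReduced (uWord x y ++ [(z, false)]) :=
    isReduced_append_of_disjoint isReduced_uWord (isReduced_of_sign (e := false) (by simp))
      fun p hp q hq => by
        obtain rfl := List.mem_singleton.1 hq
        exact hU p (List.mem_of_mem_getLast? hp)
  refine isReduced_append_iff.2 ⟨hr, hr, fun p hp q hq e => ?_⟩
  obtain rfl : (z, false) = p := by simpa using hp
  have hne : uWord x y ≠ [] := fun h => by simpa [h] using length_uWord x y
  rw [List.head?_append_of_ne_nil _ hne] at hq
  exact absurd e.symm (hU q (List.mem_of_mem_head? hq))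

theorem good_of_dehnMinimal {v : Word KGen} (hv : DehnMinimal KRelWords v) (y : Option ℤ)
    (w : ℕ × List ℤ) : Good 2576 (vtx w) (edge y) (vtx (move y w)) v := by
  intro t ht ha
  by_contra! hlt
  have hxz : vtx w ≠ vtx (move y w) := fun e => move_ne y w (vtx_injective e).symm
  have hyz := (vtx_ne_edge (move y w) y).symm
  set r : Word KGen := uWord (vtx w) (edge y) ++ [(vtx (move y w), false)] with hr
  have hrlen : r.length = 5151 := by simp [hr, length_uWord]
  have hrmem : r ∈ KRelWords := mem_KRelWords_iff.2 ⟨y, w, rfl⟩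
  have hrr : IsReduced (r ++ r) := isReduced_relator hxz hyz
  have harc : arc (vtx w) (edge y) (vtx (move y w)) <:+: r ++ r :=
    ⟨[], [(vtx (move y w), false)], by simp [arc, hr]⟩
  have hlen : cnt (edge y) t ≤ t.length := List.countP_le_length
  have hshort : (t.take 2576).length = 2576 := by simp; omega
  have hsub : t.take 2576 <:+: t := (List.take_prefix _ _).isInfix
  obtain ⟨c, hc, hcm, hcl⟩ : ∃ c, t.take 2576 <:+: c ∧ c ∈ symmClosure KRelWords ∧
      c.length = 5151 := by
    have hperm : ∀ {c r : Word KGen}, IsCyclicPermOf c r → c.length = r.length := by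
      rintro c r ⟨s, t, rfl, rfl⟩
      simp [add_comm]
    rcases ha.of_isInfix hsub with h | h
    · obtain ⟨c, hc, hvc⟩ := isCyclicPermOf_of_isInfix (h.trans harc) (by omega)
      exact ⟨c, hvc, mem_symmClosure_of_perm hrmem hrr (.inl hc), by rw [hperm hc, hrlen]⟩
    · have h' := invRev_isInfix (h.trans harc)
      rw [invRev_invRev, FreeGroup.invRev_append] at h'
      obtain ⟨c, hc, hvc⟩ := isCyclicPermOf_of_isInfix h' (by rw [invRev_length]; omega)
      exact ⟨c, hvc, mem_symmClosure_of_perm hrmem hrr (.inr hc), by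
        rw [hperm hc, invRev_length, hrlen]⟩
  have := hv _ c hcm (hsub.trans ht) hc
  omega

theorem lift_of_b (g : FreeGroup ℤ) :
    FreeGroup.lift (fun i => (PresentedGroup.of (KGen.b i) : K)) g =
      PresentedGroup.mk KRels (FreeGroup.map KGen.b g) :=
  DFunLike.congr_fun (g := (PresentedGroup.mk KRels).comp (FreeGroup.map KGen.b))
    (by ext i; simp [PresentedGroup.of]) g

/-- A reduced Dehn-minimal word equal in `K` to a word over `B` is itself a word over `B`. -/
theorem forall_eq_b_of_mem_closure {v : Word KGen} (hred : IsReduced v)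
    (hmin : DehnMinimal KRelWords v)
    (hv : (QuotientGroup.mk (FreeGroup.mk v) : K) ∈
      Subgroup.closure (Set.range fun i : ℤ => (PresentedGroup.of (KGen.b i) : K))) :
    ∀ p ∈ v, ∃ i : ℤ, p.1 = KGen.b i := by
  rw [← FreeGroup.range_lift_eq_closure] at hv
  obtain ⟨g, hg⟩ := hv
  set s : Word KGen := (invRev g.toWord).map fun p => (KGen.b p.1, p.2) with hs
  have hsb : ∀ p ∈ s, ∃ i : ℤ, p.1 = KGen.b i := by
    intro p hp
    obtain ⟨q, -, rfl⟩ := List.mem_map.1 hp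
    exact ⟨q.1, rfl⟩
  have hsred : IsReduced s := isReduced_map (by intro i j; simp)
    (isReduced_invRev FreeGroup.isReduced_toWord)
  have hsval : FreeGroup.mk s = (FreeGroup.map KGen.b g)⁻¹ := by
    rw [hs, ← FreeGroup.map.mk, mk_invRev, FreeGroup.mk_toWord, map_inv]
  obtain ⟨v', c, s', hv', hs', hvs⟩ := exists_cancellation hred hsred
  have hnil : v' ++ s' = [] := by
    refine eq_nil_of_mem_normalClosure hvs (fun y w => ?_) ?_
    · refine (((good_of_dehnMinimal hmin y w).of_isInfix (hv' ▸ (List.prefix_append v' c).isInfix)).append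
        (good_zero_of_forall_ne fun p hp => ?_)).mono (by simp)
      obtain ⟨i, hi⟩ := hsb p (by simp [hs', hp])
      simp [hi, vtx]
    · have h1 : FreeGroup.mk (v' ++ s') = FreeGroup.mk v * FreeGroup.mk s := by
        rw [hv', hs', mk_append, mk_append, mk_append, mk_invRev]
        group
      rw [← PresentedGroup.mk_eq_one_iff, h1, map_mul, hsval, map_inv, ← lift_of_b, hg]
      exact mul_inv_cancel (PresentedGroup.mk KRels (FreeGroup.mk v))
  obtain ⟨rfl, rfl⟩ := List.append_eq_nil_iff.1 hnil
  intro p hp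
  rw [hv', List.nil_append] at hp
  obtain ⟨i, hi⟩ := hsb (p.1, !p.2) (by
    rw [hs', List.append_nil, mem_invRev]
    simpa using hp)
  exact ⟨i, hi⟩

end Dehn

end SmallCancellation

/-- A reduced Dehn-minimal word over the generators of `K` represents an element of the
subgroup generated by `B = {bᵢ}` iff all its letters come from `B`. -/
theorem stmt10 (v : Word KGen) (hred : IsReducedWord v) (hmin : DehnMinimal KRelWords v) :
    (QuotientGroup.mk (FreeGroup.mk v) : K) ∈
        Subgroup.closure (Set.range fun i : ℤ => (PresentedGroup.of (KGen.b i) : K)) ↔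
      ∀ p ∈ v, ∃ i : ℤ, p.1 = KGen.b i := by
  refine ⟨SmallCancellation.forall_eq_b_of_mem_closure
    (SmallCancellation.isReducedWord_iff.1 hred) hmin, fun h => ?_⟩
  obtain ⟨w, rfl⟩ := SmallCancellation.exists_map_eq KGen.b fun q hq =>
    (h q hq).imp fun _ e => e.symm
  rw [← FreeGroup.range_lift_eq_closure]
  refine ⟨FreeGroup.mk w, ?_⟩
  rw [SmallCancellation.lift_of_b, FreeGroup.map.mk]
  rfl
end

section
/- Let R be a nontrivial ring, let ι*: R[G] → R[G] be the injective ring endomorphism of the group ring R[G] induced by ι (acting on group elements by ι and fixing R), and let B = ι*(R[G]) be its image. Then for every finite subset T ⊆ R[G] with 0 ∉ T, there exists a ring endomorphism β: R[G] → R[G] such that β restricted to B is the identity, β(R[G]) = B, and 0 ∉ β(T). -/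
/-- Generators of `G`: the generators of `K` together with the stable letter `t = none`. -/
abbrev GGen := Option KGen

/-- The relator words of the presentation of `G = ⟨K, t ∣ t bᵢ t⁻¹ = b_{i+1}⟩`:
the relators of `K` together with `t bᵢ t⁻¹ b_{i+1}⁻¹`. -/
def GRelWords : Set (Word GGen) :=
  (fun w : Word KGen => w.map fun p => (some p.1, p.2)) '' KRelWords ∪
    { w | ∃ i : ℤ, w = [((none : GGen), true), (some (KGen.b i), true), ((none : GGen), false),
        (some (KGen.b (i + 1)), false)] }

/-- The relators of `G` as elements of the free group. -/
def GRels : Set (FreeGroup GGen) := FreeGroup.mk '' GRelWords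

/-- The group `G`, the HNN extension of `K` along `bᵢ ↦ b_{i+1}`. -/
abbrev G := PresentedGroup GRels

/-- The vertex `(n,τ)` as an element of `G`. -/
def gvert (n : ℕ) (τ : List ℤ) : G := PresentedGroup.of (some (KGen.vert n τ))

/-- `a` as an element of `G`. -/
def ga : G := PresentedGroup.of (some KGen.a)

/-- `bᵢ` as an element of `G`. -/
def gb (i : ℤ) : G := PresentedGroup.of (some (KGen.b i))

/-- The stable letter `t` as an element of `G`. -/
def gt' : G := PresentedGroup.of (none : GGen)

/-- The subgroup `H` of `G` generated by `(1,⟨⟩)`, `a`, `b₀` and `t`. -/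
def H : Subgroup G := Subgroup.closure {gvert 1 [], ga, gb 0, gt'}

namespace TreeGroup

/-- The vertices of the tree. -/
abbrev Vtx := ℕ × List ℤ

/-- The map of the tree to itself that pushes the vertices down one level and hangs the
subtree at `(0, ⟨⟩)` below its `j`-th child. It undoes the shift `(n, τ) ↦ (n + 1, τ)`. -/
def fold (j : ℤ) : Vtx → Vtx
  | (0, τ) => (0, j :: τ)
  | (n + 1, τ) => (n, τ)

/-- The parent of `v` (label `none`), or its `i`-th child (label `some i`). -/
def next (v : Vtx) : Option ℤ → Vtx
  | none => parent v.1 v.2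
  | some i => (v.1, v.2 ++ [i])

theorem parent_append_singleton (n : ℕ) (τ : List ℤ) (i : ℤ) : parent n (τ ++ [i]) = (n, τ) := by
  rcases τ with _ | ⟨h, l⟩
  · rfl
  · exact Prod.ext rfl (List.dropLast_concat (l₁ := h :: l))

theorem next_ne (v : Vtx) (s : Option ℤ) : next v s ≠ v := by
  obtain ⟨n, τ⟩ := v
  rcases s with _ | i
  · rcases List.eq_nil_or_concat τ with rfl | ⟨l, i, rfl⟩
    · simp [next, parent]
    · simp [next, parent_append_singleton]
  · simp [next]

theorem next_some_injective (v : Vtx) : Function.Injective fun i => next v (some i) := by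
  intro i i' h
  simpa [next] using h

theorem next_fold (j : ℤ) (v : Vtx) (s : Option ℤ) : next (fold j v) s = fold j (next v s) := by
  obtain ⟨n, τ⟩ := v
  rcases s with _ | i
  · rcases List.eq_nil_or_concat τ with rfl | ⟨l, i, rfl⟩
    · rcases n with _ | n <;> simp [next, parent, fold]
    · rcases n with _ | n
      · rw [List.concat_eq_append]
        simp only [next, fold, parent_append_singleton]
        rw [← List.cons_append, parent_append_singleton]
      · simp [next, fold, parent_append_singleton]
  · rcases n with _ | n <;> simp [next, fold]

theorem eventually_fold_ne {v w : Vtx} (h : v ≠ w) : ∀ᶠ j in Filter.cofinite, fold j v ≠ fold j w := by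
  refine Filter.eventually_cofinite.2 (Set.Finite.subset (Set.toFinite {v.2.headI, w.2.headI}) ?_)
  obtain ⟨n, τ⟩ := v
  obtain ⟨m, τ'⟩ := w
  intro j hj
  rcases n with _ | n <;> rcases m with _ | m <;> simp_all [fold]
  exact Or.inr (by simp [← hj.2])

/-- Generators of the syllable groups. -/
inductive Ltr : Type
  | vert : Vtx → Ltr
  | t | a | b
  deriving DecidableEq

/-- The free group on the letters. -/
abbrev M := FreeGroup Ltr

/-- The effect of `fold j` on letters. -/
def foldLtr (j : ℤ) : Ltr → Ltr
  | .vert v => .vert (fold j v)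
  | x => x

theorem eventually_foldLtr_ne {x y : Ltr} (h : x ≠ y) :
    ∀ᶠ j in Filter.cofinite, foldLtr j x ≠ foldLtr j y := by
  rcases x with v | _ | _ | _ <;> rcases y with w | _ | _ | _ <;>
    first
      | exact absurd rfl h
      | exact .of_forall fun j => Ltr.noConfusion
      | skip
  filter_upwards [eventually_fold_ne fun hv => h (congrArg _ hv)] with j hj
  simpa [foldLtr] using hj

theorem eventually_injOn_of_finite {α β : Type*} {r : ℤ → α → β}
    (hr : ∀ x y, x ≠ y → ∀ᶠ j in Filter.cofinite, r j x ≠ r j y) {s : Set α} (hs : s.Finite) :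
    ∀ᶠ j in Filter.cofinite, Set.InjOn (r j) s := by
  have : ∀ᶠ j in Filter.cofinite, ∀ x ∈ s, ∀ y ∈ s, x ≠ y → r j x ≠ r j y := by
    rw [Filter.eventually_all_finite hs]
    intro x _
    rw [Filter.eventually_all_finite hs]
    intro y _
    by_cases h : x = y
    · simp [h]
    · filter_upwards [hr x y h] with j hj _ using hj
  filter_upwards [this] with j hj x hx y hy hxy
  by_contra h
  exact hj x hx y hy h hxy

/-- The exponent of `t` attached to an edge label. -/
def shift : Option ℤ → ℤ
  | none => 0
  | some i => i

/-- The letter attached to an edge label. -/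
def lastLtr : Option ℤ → Ltr
  | none => .a
  | some _ => .b

/-- The vertex letters of the `k`-th syllable of the relator at the edge `(v, s)`. -/
def body (v : Vtx) (s : Option ℤ) (k : ℕ) : M :=
  if k = 0 then (FreeGroup.of (.vert (next v s)))⁻¹ * FreeGroup.of (.vert v)
  else FreeGroup.of (.vert v) ^ (k + 1)

/-- The `k`-th syllable of the relator at the edge `(v, s)`. -/
def syl (v : Vtx) (s : Option ℤ) (k : ℕ) : M :=
  FreeGroup.of .t ^ (-shift s) * body v s k * FreeGroup.of .t ^ shift s * FreeGroup.of (lastLtr s)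

theorem map_foldLtr_syl (j : ℤ) (v : Vtx) (s : Option ℤ) (k : ℕ) :
    FreeGroup.map (foldLtr j) (syl v s k) = syl (fold j v) s k := by
  have h : foldLtr j (lastLtr s) = lastLtr s := by cases s <;> rfl
  have ht : foldLtr j .t = .t := rfl
  simp only [syl, map_mul, map_zpow, FreeGroup.map.of, h, ht, body]
  split_ifs <;> simp [foldLtr, next_fold]

/-- The exponent sum of a letter. -/
def expSum (x : Ltr) : M →* Multiplicative ℤ :=
  FreeGroup.lift fun y => Multiplicative.ofAdd (if y = x then 1 else 0)

theorem expSum_vert_syl (w v : Vtx) (s : Option ℤ) (k : ℕ) :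
    (expSum (.vert w) (syl v s k)).toAdd =
      if v = w then (k + 1 : ℤ) else if k = 0 ∧ next v s = w then -1 else 0 := by
  have h : (lastLtr s = .vert w) = False := by cases s <;> simp [lastLtr]
  have h1 := next_ne v s
  simp only [syl, map_mul, map_zpow, expSum, FreeGroup.lift_apply_of, body]
  split_ifs <;> simp_all

theorem expSum_a_syl (v : Vtx) (s : Option ℤ) (k : ℕ) :
    (expSum .a (syl v s k)).toAdd = if s = none then 1 else 0 := by
  cases s <;> simp only [syl, map_mul, map_zpow, expSum, FreeGroup.lift_apply_of, body] <;> split_ifs <;> simp_all [lastLtr]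

theorem syl_ne_one (v : Vtx) (s : Option ℤ) (k : ℕ) : syl v s k ≠ 1 := by
  intro h
  have := expSum_vert_syl v v s k
  rw [h] at this
  simp at this
  omega

/-- An affine action of the free group on `ℚ` in which `t` translates and vertices dilate. -/
def affine : M →* Equiv.Perm ℚ :=
  FreeGroup.lift fun
    | .vert _ => Equiv.mulLeft₀ 2 two_ne_zero
    | .t => Equiv.addRight 1
    | _ => 1

theorem affine_vert_pow (v : Vtx) (k : ℕ) (q : ℚ) :
    affine (FreeGroup.of (.vert v) ^ k) q = 2 ^ k * q := by
  induction k generalizing q with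
  | zero => simp
  | succ k ih => rw [pow_succ', map_mul, Equiv.Perm.mul_apply, ih]; simp [affine]; ring

theorem affine_t_zpow (i : ℤ) (q : ℚ) : affine (FreeGroup.of .t ^ i) q = q + i := by
  have ht (q : ℚ) : affine (FreeGroup.of .t) q = q + 1 := by simp [affine]
  have ht' (q : ℚ) : affine (FreeGroup.of .t)⁻¹ q = q - 1 := by
    rw [map_inv, Equiv.Perm.inv_eq_iff_eq, ht, sub_add_cancel]
  induction i generalizing q with
  | zero => simp
  | succ n ih => rw [zpow_add_one, map_mul, Equiv.Perm.mul_apply, ht, ih]; push_cast; ring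
  | pred n ih => rw [zpow_sub_one, map_mul, Equiv.Perm.mul_apply, ht', ih]; push_cast; ring

theorem affine_syl (v : Vtx) (s : Option ℤ) (k : ℕ) (hk : k ≠ 0) :
    affine (syl v s k) 0 = (2 ^ (k + 1) - 1) * shift s := by
  have h : affine (FreeGroup.of (lastLtr s)) = 1 := by cases s <;> simp [affine, lastLtr]
  rw [syl, body, if_neg hk, map_mul, map_mul, map_mul, h]
  simp only [Equiv.Perm.mul_apply, mul_one, affine_t_zpow, affine_vert_pow]
  push_cast
  ring

theorem syl_injective {v v' : Vtx} {s s' : Option ℤ} {k k' : ℕ} (h : syl v s k = syl v' s' k') :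
    v = v' ∧ s = s' ∧ k = k' := by
  have hc (w : Vtx) := congrArg (fun m => (expSum (.vert w) m).toAdd) h
  simp only [expSum_vert_syl] at hc
  have hv : v = v' := by
    by_contra hv
    have := hc v
    simp only [if_true, Ne.symm hv, if_false] at this
    split_ifs at this <;> omega
  subst hv
  have hk : k = k' := by simpa using hc v
  subst hk
  refine ⟨rfl, ?_, rfl⟩
  have hs := congrArg (fun m => (expSum .a m).toAdd) h
  simp only [expSum_a_syl] at hs
  rcases s with _ | i <;> rcases s' with _ | i' <;> simp at hs ⊢
  by_cases hk : k = 0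
  · have := hc (next v (some i))
    simp only [(next_ne _ _).symm, if_false, hk, true_and, if_true] at this
    split_ifs at this with h1
    exact next_some_injective v h1.symm
  · have h2 := congrArg (fun m => affine m 0) h
    simp only [affine_syl _ _ _ hk, shift] at h2
    have : (2 : ℚ) ^ (k + 1) - 1 ≠ 0 := by
      have : (1 : ℚ) < 2 ^ (k + 1) := one_lt_pow₀ (by norm_num) (by omega)
      linarith
    exact_mod_cast mul_left_cancel₀ this h2

/-- An edge of the tree (a vertex with an edge label) together with a rotation. -/
abbrev Edge := Vtx × Option ℤ × ZMod 100

/-- The effect of `fold j` on edges. -/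
def foldEdge (j : ℤ) (f : Edge) : Edge := (fold j f.1, f.2)

theorem eventually_foldEdge_ne {x y : Edge} (h : x ≠ y) :
    ∀ᶠ j in Filter.cofinite, foldEdge j x ≠ foldEdge j y := by
  by_cases h1 : x.1 = y.1
  · have h2 : x.2 ≠ y.2 := fun h2 => h (Prod.ext h1 h2)
    exact .of_forall fun j (hj : (_, x.2) = (_, y.2)) => h2 (Prod.mk.inj hj).2
  · filter_upwards [eventually_fold_ne h1] with j hj (h2 : (_, x.2) = (_, y.2)) using
      hj (Prod.mk.inj h2).1

/-- The syllable at position `c` of the rotated relator `f`. -/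
def edgeSyl (f : Edge) (c : ℕ) : M := syl f.1 f.2.1 (f.2.2 + (c : ZMod 100)).val

theorem edgeSyl_ne_one (f : Edge) (c : ℕ) : edgeSyl f c ≠ 1 := syl_ne_one _ _ _

theorem edgeSyl_injective (c : ℕ) : Function.Injective fun f => edgeSyl f c := by
  rintro ⟨v, s, σ⟩ ⟨v', s', σ'⟩ h
  obtain ⟨h1, h2, h3⟩ := syl_injective h
  have := ZMod.val_injective 100 h3
  simp_all

theorem map_foldLtr_edgeSyl (j : ℤ) (f : Edge) (c : ℕ) :
    FreeGroup.map (foldLtr j) (edgeSyl f c) = edgeSyl (foldEdge j f) c := map_foldLtr_syl _ _ _ _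

section FreeProduct

variable {I N E : Type*} [Group N]

/-- The free product of copies of `N` indexed by `I`. -/
abbrev Copies (I N : Type*) [Group N] := Monoid.CoprodI fun _ : I => N

/-- The inclusion of the `i`-th factor. -/
abbrev inc (i : I) : N →* Copies I N := Monoid.CoprodI.of (M := fun _ : I => N) (i := i)

/-- A list of syllables is reduced if no syllable is trivial and neighbours lie in
different factors. -/
def IsRed (l : List (I × N)) : Prop :=
  (∀ x ∈ l, x.2 ≠ 1) ∧ (l.map Prod.fst).IsChain (· ≠ ·)

/-- The product of a list of syllables. -/
def ev (l : List (I × N)) : Copies I N := (l.map fun x => inc x.1 x.2).prod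

@[simp] theorem ev_nil : ev ([] : List (I × N)) = 1 := rfl

@[simp] theorem ev_cons (x : I × N) (l : List (I × N)) : ev (x :: l) = inc x.1 x.2 * ev l := by
  simp [ev]

@[simp] theorem ev_append (l l' : List (I × N)) : ev (l ++ l') = ev l * ev l' := by simp [ev]

/-- A reduced list of syllables as a word of Mathlib. -/
def IsRed.toWord {l : List (I × N)} (h : IsRed l) : Monoid.CoprodI.Word fun _ : I => N where
  toList := l.map fun x => ⟨x.1, x.2⟩
  ne_one := by
    simp only [List.mem_map]
    rintro _ ⟨x, hx, rfl⟩
    exact h.1 x hx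
  chain_ne := by
    have := h.2
    rw [List.isChain_map] at this ⊢
    exact this

theorem IsRed.prod_toWord {l : List (I × N)} (h : IsRed l) : h.toWord.prod = ev l := by
  simp [Monoid.CoprodI.Word.prod, IsRed.toWord, ev, Function.comp_def]

theorem IsRed.eq_of_ev_eq {l l' : List (I × N)} (h : IsRed l) (h' : IsRed l') (he : ev l = ev l') :
    l = l' := by
  classical
  rw [← h.prod_toWord, ← h'.prod_toWord] at he
  have := congrArg Monoid.CoprodI.Word.toList (Monoid.CoprodI.Word.equiv.symm.injective he)
  simp only [IsRed.toWord] at this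
  refine List.map_injective_iff.2 ?_ this
  rintro ⟨i, m⟩ ⟨i', m'⟩ h
  simpa using h

theorem exists_isRed (x : Copies I N) : ∃ l : List (I × N), IsRed l ∧ ev l = x := by
  classical
  let w := Monoid.CoprodI.Word.equiv x
  have hw : w.prod = x := Monoid.CoprodI.Word.equiv.symm_apply_apply x
  refine ⟨w.toList.map fun x => (x.1, x.2), ⟨?_, ?_⟩, ?_⟩
  · simp only [List.mem_map]
    rintro _ ⟨x, hx, rfl⟩
    exact w.ne_one x hx
  · have := w.chain_ne
    rw [List.isChain_map, List.isChain_map]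
    exact this
  · rw [← hw]
    simp [Monoid.CoprodI.Word.prod, ev, Function.comp_def]

/-- When reduced blocks are multiplied and the junctions merge without cancelling, the interior
syllables of every block survive. -/
theorem exists_isRed_of_blocks {S : Type*} (α ω : S → I × N) (core : S → List (I × N))
    (hred : ∀ e, IsRed (α e :: (core e ++ [ω e]))) (e : S) (L : List S)
    (hL : (e :: L).IsChain fun e e' => (ω e).1 = (α e').1 → (ω e).2 * (α e').2 ≠ 1) :
    ∃ rest, IsRed (α e :: (core e ++ rest)) ∧
      ev (α e :: (core e ++ rest)) =
        ((e :: L).map fun e => ev (α e :: (core e ++ [ω e]))).prod ∧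
      ∀ e' ∈ e :: L, ∀ x ∈ core e', x ∈ core e ++ rest := by
  induction L generalizing e with
  | nil => exact ⟨[ω e], hred e, by simp, by simp +contextual⟩
  | cons e' L ih =>
    rw [List.isChain_cons_cons] at hL
    obtain ⟨rest, ⟨h1, h2⟩, h3, h4⟩ := ih e' hL.2
    obtain ⟨g1, g2⟩ := hred e
    by_cases hi : (ω e).1 = (α e').1
    · refine ⟨((ω e).1, (ω e).2 * (α e').2) :: (core e' ++ rest), ⟨?_, ?_⟩, ?_, ?_⟩
      · simp only [List.mem_cons, List.mem_append] at h1 g1 ⊢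
        rintro x (rfl | hx | rfl | hx)
        · exact g1 _ (.inl rfl)
        · exact g1 _ (.inr (.inl hx))
        · exact hL.1 hi
        · exact h1 _ (.inr hx)
      · simp only [List.map_cons, List.map_append, List.map_nil] at h2 g2 ⊢
        rw [← List.cons_append] at g2 ⊢
        rw [List.isChain_split]
        refine ⟨g2, ?_⟩
        rw [hi]
        exact h2
      · rw [List.map_cons, List.prod_cons, ← h3]
        simp [mul_assoc, hi]
      · simp only [List.mem_cons, List.mem_append] at h4 ⊢
        rintro e'' (rfl | h) x hx
        · exact .inl hx
        · exact .inr (.inr (h4 e'' h x hx))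
    · refine ⟨ω e :: α e' :: (core e' ++ rest), ⟨?_, ?_⟩, ?_, ?_⟩
      · simp only [List.mem_cons, List.mem_append] at h1 g1 ⊢
        rintro x (rfl | hx | rfl | hx)
        · exact g1 _ (.inl rfl)
        · exact g1 _ (.inr (.inl hx))
        · exact g1 _ (by simp)
        · exact h1 _ hx
      · simp only [List.map_cons, List.map_append, List.map_nil] at h2 g2 ⊢
        rw [← List.cons_append] at g2 ⊢
        rw [List.isChain_split]
        refine ⟨g2, ?_⟩
        rw [List.isChain_cons_cons]
        exact ⟨hi, h2⟩
      · rw [List.map_cons, List.prod_cons, ← h3]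
        simp [mul_assoc]
      · simp only [List.mem_cons, List.mem_append] at h4 ⊢
        rintro e'' (rfl | h) x hx
        · exact .inl hx
        · exact .inr (.inr (.inr (h4 e'' h x hx)))

/-- The product over a list of indices of one syllable from each factor. -/
def block (y : E → I → N) (l : List I) (f : E) : Copies I N := (l.map fun c => inc c (y f c)).prod

theorem exists_isRed_lift_block {y : E → I → N} (hy : ∀ c, Function.Injective fun f => y f c)
    (hy1 : ∀ f c, y f c ≠ 1) {c₀ c₁ : I} {mid : List I} (hl : (c₀ :: (mid ++ [c₁])).Nodup)
    [DecidableEq E]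
    {u : FreeGroup E} (hu : u ≠ 1) :
    ∃ l : List (I × N), IsRed l ∧ l ≠ [] ∧
      ev l = FreeGroup.lift (block y (c₀ :: (mid ++ [c₁]))) u ∧
      ∀ e ∈ u.toWord, ∀ c ∈ mid, (c, y e.1 c) ∈ l ∨ (c, (y e.1 c)⁻¹) ∈ l := by
  let α : E × Bool → I × N := fun e => if e.2 then (c₀, y e.1 c₀) else (c₁, (y e.1 c₁)⁻¹)
  let ω : E × Bool → I × N := fun e => if e.2 then (c₁, y e.1 c₁) else (c₀, (y e.1 c₀)⁻¹)
  let core : E × Bool → List (I × N) := fun e =>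
    if e.2 then mid.map fun c => (c, y e.1 c) else mid.reverse.map fun c => (c, (y e.1 c)⁻¹)
  have hred (e) : IsRed (α e :: (core e ++ [ω e])) := by
    obtain ⟨f, b⟩ := e
    cases b
    · refine ⟨?_, ?_⟩
      · rintro x hx
        simp only [α, core, ω, List.mem_cons, List.mem_append, List.mem_map, Bool.false_eq_true,
          if_false, List.not_mem_nil, or_false] at hx
        rcases hx with rfl | ⟨c, _, rfl⟩ | rfl <;> simp [hy1]
      · have : (c₁ :: (mid.reverse ++ [c₀])).Nodup := by
          have := List.nodup_reverse.2 hl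
          simpa using this
        simpa [α, core, ω, Function.comp_def] using List.Pairwise.isChain this
    · refine ⟨?_, ?_⟩
      · rintro x hx
        simp only [α, core, ω, List.mem_cons, List.mem_append, List.mem_map, if_true,
          List.not_mem_nil, or_false] at hx
        rcases hx with rfl | ⟨c, _, rfl⟩ | rfl <;> simp [hy1]
      · simpa [α, core, ω, Function.comp_def] using List.Pairwise.isChain hl
  have hev (e) : ev (α e :: (core e ++ [ω e])) =
      cond e.2 (block y (c₀ :: (mid ++ [c₁])) e.1) (block y (c₀ :: (mid ++ [c₁])) e.1)⁻¹ := by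
    obtain ⟨f, b⟩ := e
    cases b
    · simp [α, core, ω, block, ev, List.prod_inv_reverse, Function.comp_def, mul_assoc]
    · simp [α, core, ω, block, ev, Function.comp_def]
  have hc : c₀ ≠ c₁ := by
    rintro rfl
    simp at hl
  have hR : u.toWord.IsChain fun e e' => (ω e).1 = (α e').1 → (ω e).2 * (α e').2 ≠ 1 := by
    refine List.IsChain.imp ?_ FreeGroup.isReduced_toWord
    rintro ⟨f, b⟩ ⟨f', b'⟩ h
    have h0 := @hy c₀ f f'
    have h1 := @hy c₁ f f'
    cases b <;> cases b' <;> simp_all [α, ω, mul_inv_eq_one, inv_mul_eq_one, hc.symm]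
  rcases hw : u.toWord with _ | ⟨e, L⟩
  · exact absurd (FreeGroup.toWord_eq_nil_iff.1 hw) hu
  · rw [hw] at hR
    obtain ⟨rest, h1, h2, h3⟩ := exists_isRed_of_blocks α ω core hred e L hR
    refine ⟨_, h1, by simp, ?_, ?_⟩
    · rw [h2, ← FreeGroup.mk_toWord (x := u), hw, FreeGroup.lift_mk]
      simp only [hev]
    · rintro e' he' c hc
      have := h3 e' he'
      obtain ⟨f, b⟩ := e'
      cases b
      · exact .inr (List.mem_cons_of_mem _ (this _ (by simpa [core] using hc)))
      · exact .inl (List.mem_cons_of_mem _ (this _ (by simpa [core] using hc)))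

theorem lift_block_injective {y : E → I → N} (hy : ∀ c, Function.Injective fun f => y f c)
    (hy1 : ∀ f c, y f c ≠ 1) {c₀ c₁ : I} {mid : List I} (hl : (c₀ :: (mid ++ [c₁])).Nodup) :
    Function.Injective (FreeGroup.lift (block y (c₀ :: (mid ++ [c₁])))) := by
  classical
  rw [injective_iff_map_eq_one]
  intro u hu
  by_contra h
  obtain ⟨l, h1, h2, h3, -⟩ := exists_isRed_lift_block hy hy1 hl h
  exact h2 (h1.eq_of_ev_eq (l' := []) (by simp [IsRed]) (by rw [h3, hu, ev_nil]))

end FreeProduct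

/-- The letters occurring in the reduced form of an element of a free group. -/
def letters {α : Type*} [DecidableEq α] (x : FreeGroup α) : Set α := {a | ∃ b, (a, b) ∈ x.toWord}

theorem finite_letters {α : Type*} [DecidableEq α] (x : FreeGroup α) : (letters x).Finite := by
  refine (x.toWord.map Prod.fst).toFinset.finite_toSet.subset ?_
  rintro a ⟨b, hb⟩
  simp only [List.coe_toFinset, Set.mem_ofPred_eq]
  exact List.mem_map.2 ⟨_, hb, rfl⟩

theorem mk_mem_closure {α : Type*} (L : List (α × Bool)) :
    FreeGroup.mk L ∈ Subgroup.closure (FreeGroup.of '' {a | ∃ b, (a, b) ∈ L}) := by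
  induction L with
  | nil => exact one_mem _
  | cons e L ih =>
    have hL : FreeGroup.mk (e :: L) = FreeGroup.mk [e] * FreeGroup.mk L := by
      rw [FreeGroup.mul_mk, List.singleton_append]
    rw [hL]
    refine mul_mem ?_ (Subgroup.closure_mono (Set.image_mono ?_) ih)
    · have : FreeGroup.of e.1 ∈
          Subgroup.closure (FreeGroup.of '' {a | ∃ b, (a, b) ∈ e :: L}) :=
        Subgroup.subset_closure ⟨e.1, ⟨e.2, by simp⟩, rfl⟩
      obtain ⟨a, b⟩ := e
      cases b
      · exact inv_mem this
      · exact this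
    · rintro a ⟨b, hb⟩
      exact ⟨b, List.mem_cons_of_mem _ hb⟩

theorem mem_closure_letters {α : Type*} [DecidableEq α] (x : FreeGroup α) :
    x ∈ Subgroup.closure (FreeGroup.of '' letters x) := by
  have := mk_mem_closure x.toWord
  rwa [FreeGroup.mk_toWord] at this

theorem hom_eq_of_letters {α Q : Type*} [DecidableEq α] [Group Q] {F F' : FreeGroup α →* Q}
    {x : FreeGroup α} (h : ∀ a ∈ letters x, F (FreeGroup.of a) = F' (FreeGroup.of a)) :
    F x = F' x := by
  refine MonoidHom.eqOn_closure (f := F) (g := F') ?_ (mem_closure_letters x)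
  rintro _ ⟨a, ha, rfl⟩
  exact h a ha

theorem map_map_eq_self {α : Type*} [DecidableEq α] {r g : α → α} {s : Set α}
    (h : Set.LeftInvOn g r s) {x : FreeGroup α} (hx : letters x ⊆ s) :
    FreeGroup.map g (FreeGroup.map r x) = x := by
  refine hom_eq_of_letters (F := (FreeGroup.map g).comp (FreeGroup.map r)) (F' := MonoidHom.id _) ?_
  intro a ha
  simp [h (hx ha)]

/-- If `r j` separates points for almost all `j`, then so does the induced map of free groups. -/
theorem eventually_map_ne_one {α : Type*} [DecidableEq α] {r : ℤ → α → α}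
    (hr : ∀ x y, x ≠ y → ∀ᶠ j in Filter.cofinite, r j x ≠ r j y) {x : FreeGroup α} (hx : x ≠ 1) :
    ∀ᶠ j in Filter.cofinite, FreeGroup.map (r j) x ≠ 1 := by
  rcases isEmpty_or_nonempty α with h | h
  · exact absurd (Subsingleton.elim x 1) hx
  filter_upwards [eventually_injOn_of_finite hr (finite_letters x)] with j hj h1
  rw [← map_map_eq_self hj.leftInvOn_invFunOn subset_rfl, h1, map_one] at hx
  exact hx rfl

/-- The free product of countably many copies of the free group on the letters. -/
abbrev P := Copies ℕ M

/-- The endomorphism of `P` acting on every factor. -/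
def copiesMap (F : M →* M) : P →* P := Monoid.CoprodI.lift fun i => (inc i).comp F

@[simp] theorem copiesMap_inc (F : M →* M) (c : ℕ) (m : M) :
    copiesMap F (inc c m) = inc c (F m) := Monoid.CoprodI.lift_of ..

theorem copiesMap_ev (F : M →* M) (l : List (ℕ × M)) :
    copiesMap F (ev l) = ev (l.map fun x => (x.1, F x.2)) := by
  induction l with
  | nil => simp
  | cons x l ih => simp [ih]

theorem copiesMap_block (F : M →* M) {E E' : Type*} {y : E → ℕ → M} {y' : E' → ℕ → M} {l : List ℕ}
    {f : E} {f' : E'} (h : ∀ c ∈ l, F (y f c) = y' f' c) :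
    copiesMap F (block y l f) = block y' l f' := by
  rw [block, block, map_list_prod, List.map_map]
  congr 1
  exact List.map_congr_left fun c hc => by simp [h c hc]

/-- The indices of the syllables in one half of a relator, without the extreme ones. -/
def mid : Bool → List ℕ
  | true => List.range' 1 48
  | false => (List.range' 51 48).reverse

/-- The indices of the syllables in one half of a relator. -/
def half (ε : Bool) : List ℕ := (bif ε then 0 else 99) :: (mid ε ++ [bif ε then 49 else 50])

theorem nodup_half (ε : Bool) : (half ε).Nodup := by cases ε <;> decide

/-- The syllables of one half of a relator. -/
def halfSyl (ε : Bool) (f : Edge) (c : ℕ) : M := bif ε then edgeSyl f c else (edgeSyl f c)⁻¹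

theorem halfSyl_ne_one (ε : Bool) (f : Edge) (c : ℕ) : halfSyl ε f c ≠ 1 := by
  cases ε <;> simp [halfSyl, edgeSyl_ne_one]

theorem halfSyl_injective (ε : Bool) (c : ℕ) : Function.Injective fun f => halfSyl ε f c := by
  intro f f' h
  refine edgeSyl_injective c ?_
  cases ε <;> simpa [halfSyl] using h

theorem map_halfSyl {F : M →* M} {f f' : Edge} {c : ℕ} (ε : Bool)
    (h : F (edgeSyl f c) = edgeSyl f' c) : F (halfSyl ε f c) = halfSyl ε f' c := by
  cases ε <;> simp [halfSyl, h]

/-- The inclusions of the amalgamated subgroup: an edge goes to one half of its relator. -/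
def amalg (ε : Bool) : FreeGroup Edge →* P := FreeGroup.lift (block (halfSyl ε) (half ε))

theorem amalg_injective (ε : Bool) : Function.Injective (amalg ε) :=
  lift_block_injective (halfSyl_injective ε) (halfSyl_ne_one ε) (nodup_half ε)

theorem exists_mem_mid (ε : Bool) (σ : ZMod 100) : ∃ c ∈ mid ε, (σ + (c : ZMod 100)).val ≠ 0 := by
  by_contra! h
  obtain ⟨c, h1, h2⟩ : ∃ c, c ∈ mid ε ∧ c + 1 ∈ mid ε := by
    cases ε
    · exact ⟨51, by decide⟩
    · exact ⟨1, by decide⟩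
  have h1 := (ZMod.val_eq_zero _).1 (h _ h1)
  have h2 := (ZMod.val_eq_zero _).1 (h _ h2)
  push_cast at h2
  rw [← add_assoc, h1, zero_add] at h2
  revert h2
  decide

theorem copiesMap_amalg (j : ℤ) (ε : Bool) (h : FreeGroup Edge) :
    copiesMap (FreeGroup.map (foldLtr j)) (amalg ε h) = amalg ε (FreeGroup.map (foldEdge j) h) := by
  refine DFunLike.congr_fun (f := (copiesMap (FreeGroup.map (foldLtr j))).comp (amalg ε))
    (g := (amalg ε).comp (FreeGroup.map (foldEdge j))) ?_ h
  ext f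
  simp only [amalg, MonoidHom.comp_apply, FreeGroup.lift_apply_of, FreeGroup.map.of]
  exact copiesMap_block _ fun c _ => map_halfSyl ε (map_foldLtr_edgeSyl j f c)

theorem map_map_syl {g : Ltr → Ltr} {j : ℤ} {s : Set Ltr} (h : Set.LeftInvOn g (foldLtr j) s)
    {v : Vtx} (hv : .vert v ∈ s) (ht : .t ∈ s) (ha : .a ∈ s) (hb : .b ∈ s) {l : Option ℤ} {k : ℕ}
    (hk : k ≠ 0) : FreeGroup.map g (FreeGroup.map (foldLtr j) (syl v l k)) = syl v l k := by
  have hl : lastLtr l ∈ s := by cases l <;> assumption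
  simp [syl, body, hk, h hv, h ht, h hl]

theorem exists_vert_of_expSum_ne {m : M} {j : ℤ} {v : Vtx}
    (h : expSum (.vert v) (FreeGroup.map (foldLtr j) m) ≠ 1) :
    ∃ w, .vert w ∈ letters m ∧ fold j w = v := by
  by_contra! hv
  refine h (hom_eq_of_letters (F := (expSum (.vert v)).comp (FreeGroup.map (foldLtr j))) (F' := 1) ?_)
  rintro (w | _ | _ | _) hw
  · simp [expSum, foldLtr, hv w hw]
  all_goals simp [expSum, foldLtr]

/-- An element outside an amalgamated subgroup is mapped outside of it by almost all foldings. -/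
theorem eventually_notMem_range_amalg (ε : Bool) {x : P} (hx : x ∉ (amalg ε).range) :
    ∀ᶠ j in Filter.cofinite, copiesMap (FreeGroup.map (foldLtr j)) x ∉ (amalg ε).range := by
  classical
  obtain ⟨l, hl, rfl⟩ := exists_isRed x
  let S : Set M := {m | ∃ c, (c, m) ∈ l ∨ (c, m⁻¹) ∈ l}
  have hS : S.Finite := by
    let s : Finset M := (l.map Prod.snd).toFinset
    refine (s ∪ s.image (·⁻¹)).finite_toSet.subset ?_
    rintro m ⟨c, h | h⟩
    · simpa [s] using Or.inl ⟨c, h⟩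
    · simpa [s] using Or.inr ⟨c, h⟩
  let Φ : Set Edge := ⋃ c ∈ mid ε, (fun f => edgeSyl f c) ⁻¹' S
  have hΦ : Φ.Finite :=
    Set.Finite.biUnion (List.finite_toSet _) fun c _ => hS.preimage (edgeSyl_injective c).injOn
  let X : Set Ltr := {.t, .a, .b} ∪ (⋃ m ∈ S, letters m) ∪
    ⋃ f ∈ Φ, ⋃ c ∈ half ε, letters (edgeSyl f c)
  have hX : X.Finite := ((Set.toFinite _).union (hS.biUnion fun m _ => finite_letters m)).union
    (hΦ.biUnion fun f _ => Set.Finite.biUnion (List.finite_toSet _) fun c _ => finite_letters _)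
  have hXm {m} (hm : m ∈ S) : letters m ⊆ X := fun z ha =>
    .inl (.inr (Set.mem_biUnion hm ha))
  have hXf {f c} (hf : f ∈ Φ) (hc : c ∈ half ε) : letters (edgeSyl f c) ⊆ X := fun z ha =>
    .inr (Set.mem_biUnion hf (Set.mem_biUnion hc ha))
  filter_upwards [eventually_injOn_of_finite (fun _ _ => eventually_foldLtr_ne) hX] with j hj
  rintro ⟨u, hu⟩
  have : Nonempty Ltr := ⟨.t⟩
  obtain ⟨g, hg⟩ : ∃ g, Set.LeftInvOn g (foldLtr j) X := ⟨_, hj.leftInvOn_invFunOn⟩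
  let l' : List (ℕ × M) := l.map fun x => (x.1, FreeGroup.map (foldLtr j) x.2)
  have hl' : IsRed l' := by
    refine ⟨?_, ?_⟩
    · simp only [l', List.mem_map]
      rintro _ ⟨x, hx, rfl⟩ (h : FreeGroup.map (foldLtr j) x.2 = 1)
      refine hl.1 x hx ?_
      rw [← map_map_eq_self hg (hXm (m := x.2) ⟨x.1, .inl hx⟩), h, map_one]
    · simpa [l', Function.comp_def] using hl.2
  have key : ∀ f ∈ letters u, ∀ c ∈ mid ε, ∃ m ∈ S,
      FreeGroup.map (foldLtr j) m = edgeSyl f c := by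
    rintro f ⟨b, hb⟩ c hc
    have hu1 : u ≠ 1 := by
      rintro rfl
      simp at hb
    obtain ⟨l₂, h1, -, h2, h3⟩ := exists_isRed_lift_block (halfSyl_injective ε) (halfSyl_ne_one ε)
      (nodup_half ε) hu1
    have : l₂ = l' := h1.eq_of_ev_eq hl' (h2.trans (hu.trans (copiesMap_ev _ _)))
    subst this
    have h4 : (c, edgeSyl f c) ∈ l' ∨ (c, (edgeSyl f c)⁻¹) ∈ l' := by
      have := h3 _ hb c hc
      cases ε
      · simpa [halfSyl] using this.symm
      · simpa [halfSyl] using this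
    simp only [l', List.mem_map, Prod.mk.injEq] at h4
    rcases h4 with ⟨x, hx, rfl, h⟩ | ⟨x, hx, rfl, h⟩
    · exact ⟨x.2, ⟨x.1, .inl hx⟩, h⟩
    · exact ⟨x.2⁻¹, ⟨x.1, .inr (by simpa using hx)⟩, by rw [map_inv, h, inv_inv]⟩
  have key2 : ∀ f ∈ letters u, ∃ f' ∈ Φ, foldEdge j f' = f := by
    rintro ⟨v, s, σ⟩ hf
    obtain ⟨c, hc, hσ⟩ := exists_mem_mid ε σ
    obtain ⟨m, hm, hmf⟩ := key _ hf c hc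
    obtain ⟨w, hw, rfl⟩ : ∃ w, .vert w ∈ letters m ∧ fold j w = v := by
      refine exists_vert_of_expSum_ne ?_
      rw [hmf]
      intro h
      have := expSum_vert_syl v v s (σ + (c : ZMod 100)).val
      rw [if_pos rfl] at this
      rw [edgeSyl] at h
      simp only [h, toAdd_one] at this
      omega
    refine ⟨(w, s, σ), Set.mem_biUnion hc ?_, rfl⟩
    have : edgeSyl (w, s, σ) c = m := by
      rw [← map_map_eq_self hg (hXm hm), hmf]
      refine (map_map_syl hg (hXm hm hw) ?_ ?_ ?_ hσ).symm.trans ?_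
      · simp [X]
      · simp [X]
      · simp [X]
      · exact congrArg _ (map_foldLtr_edgeSyl j (w, s, σ) c)
    simpa [this] using hm
  choose! back hback hfold using key2
  refine hx ⟨FreeGroup.map back u, ?_⟩
  have h1 : copiesMap (FreeGroup.map g) (copiesMap (FreeGroup.map (foldLtr j)) (ev l)) = ev l := by
    rw [copiesMap_ev, copiesMap_ev, List.map_map]
    congr 1
    conv_rhs => rw [← List.map_id l]
    refine List.map_congr_left fun x hx => Prod.ext rfl ?_
    exact map_map_eq_self hg (hXm ⟨x.1, .inl hx⟩)
  rw [← h1, ← hu]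
  refine hom_eq_of_letters (F := (amalg ε).comp (FreeGroup.map back))
    (F' := (copiesMap (FreeGroup.map g)).comp (amalg ε)) fun f hf => ?_
  simp only [amalg, MonoidHom.comp_apply, FreeGroup.lift_apply_of, FreeGroup.map.of]
  refine (copiesMap_block _ fun c hc => map_halfSyl ε ?_).symm
  conv_lhs => rw [← hfold f hf, ← map_foldLtr_edgeSyl]
  exact map_map_eq_self hg (hXf (hback f hf) hc)

/-- The amalgamated free product of two copies of `P`, in which the two halves of every
rotated relator are identified. -/
abbrev W := Monoid.PushoutI amalg

/-- The inclusion of one copy of `P`. -/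
abbrev incW (ε : Bool) : P →* W := Monoid.PushoutI.of (G := fun _ : Bool => P) (φ := amalg) ε

/-- The endomorphism of `W` induced by `fold j`. -/
def foldW (j : ℤ) : W →* W :=
  Monoid.PushoutI.lift (fun ε => (incW ε).comp (copiesMap (FreeGroup.map (foldLtr j))))
    ((Monoid.PushoutI.base amalg).comp (FreeGroup.map (foldEdge j))) (by
      intro ε
      refine MonoidHom.ext fun h => ?_
      simp only [MonoidHom.comp_apply, copiesMap_amalg]
      exact Monoid.PushoutI.of_apply_eq_base amalg ε _)

@[simp] theorem foldW_incW (j : ℤ) (ε : Bool) (x : P) :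
    foldW j (incW ε x) = incW ε (copiesMap (FreeGroup.map (foldLtr j)) x) :=
  Monoid.PushoutI.lift_of _ _ _ _

@[simp] theorem foldW_base (j : ℤ) (h : FreeGroup Edge) :
    foldW j (Monoid.PushoutI.base amalg h) =
      Monoid.PushoutI.base amalg (FreeGroup.map (foldEdge j) h) :=
  Monoid.PushoutI.lift_base _ _ _ _

theorem eventually_foldW_ne_one {w : W} (hw : w ≠ 1) :
    ∀ᶠ j in Filter.cofinite, foldW j w ≠ 1 := by
  classical
  obtain ⟨d⟩ := Monoid.PushoutI.NormalWord.transversal_nonempty amalg amalg_injective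
  let n := Monoid.PushoutI.NormalWord.equiv (d := d) w
  have hn : Monoid.PushoutI.base amalg n.head * Monoid.PushoutI.ofCoprodI n.toWord.prod = w :=
    Monoid.PushoutI.NormalWord.equiv.symm_apply_apply w
  have hnot : ∀ x ∈ n.toList, x.2 ∉ (amalg x.1).range := by
    intro x hx hr
    have h1 := n.normalized x.1 x.2 hx
    have h2 := (d.compl x.1).equiv_fst_eq_self_of_mem_of_one_mem (d.one_mem x.1) hr
    have h3 := (d.compl x.1).equiv_fst_eq_one_of_mem_of_one_mem (one_mem _) h1
    exact n.ne_one x hx (congrArg Subtype.val (h2.symm.trans h3))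
  by_cases he : n.toList = []
  · have h1 : n.toWord = .empty := Monoid.CoprodI.Word.ext he
    rw [h1, Monoid.CoprodI.Word.prod_empty, map_one, mul_one] at hn
    have h2 : n.head ≠ 1 := by
      intro h
      rw [h, map_one] at hn
      exact hw hn.symm
    filter_upwards [eventually_map_ne_one (fun _ _ => eventually_foldEdge_ne) h2] with j hj
    rw [← hn, foldW_base]
    exact fun h => hj (Monoid.PushoutI.base_injective amalg_injective (h.trans (map_one _).symm))
  · have h1 : ∀ᶠ j in Filter.cofinite, ∀ x ∈ n.toList,
        copiesMap (FreeGroup.map (foldLtr j)) x.2 ∉ (amalg x.1).range :=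
      (Filter.eventually_all_finite (List.finite_toSet _)).2 fun x hx =>
        eventually_notMem_range_amalg x.1 (hnot x hx)
    filter_upwards [h1] with j hj
    let n' : Monoid.CoprodI.Word fun _ : Bool => P :=
      { toList := n.toList.map fun x => ⟨x.1, copiesMap (FreeGroup.map (foldLtr j)) x.2⟩
        ne_one := by
          simp only [List.mem_map]
          rintro _ ⟨x, hx, rfl⟩ (h : copiesMap (FreeGroup.map (foldLtr j)) x.2 = 1)
          exact hj x hx (h ▸ one_mem _)
        chain_ne := by
          rw [List.isChain_map]
          exact n.chain_ne }
    have hn' : Monoid.PushoutI.ofCoprodI (φ := amalg) n'.prod =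
        foldW j (Monoid.PushoutI.ofCoprodI n.toWord.prod) := by
      simp only [Monoid.CoprodI.Word.prod, n', map_list_prod, List.map_map]
      congr 1
    have hred : Monoid.PushoutI.Reduced amalg n' := by
      simp only [Monoid.PushoutI.Reduced, n', List.mem_map]
      rintro _ ⟨x, hx, rfl⟩
      exact hj x hx
    intro h
    rw [← hn, map_mul, ← hn', foldW_base, mul_eq_one_iff_eq_inv'] at h
    have := hred.eq_empty_of_mem_range amalg_injective
      (h ▸ inv_mem ⟨_, rfl⟩)
    refine he ?_
    have := congrArg Monoid.CoprodI.Word.toList this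
    simpa [n', Monoid.CoprodI.Word.empty] using this

section Relators

variable {Q : Type*} [Group Q]

theorem mk_uWord {α : Type} (x y : α) : FreeGroup.mk (uWord x y) =
    ((List.range 100).map fun k => FreeGroup.of x ^ (k + 1) * FreeGroup.of y).prod := by
  have hpow (n : ℕ) : FreeGroup.mk (List.replicate n (x, true)) = FreeGroup.of x ^ n := by
    induction n with
    | zero => rfl
    | succ n ih =>
      rw [pow_succ', ← ih, List.replicate_succ, FreeGroup.of, FreeGroup.mul_mk, List.singleton_append]
  rw [uWord]
  induction List.range 100 with
  | nil => rfl
  | cons k l ih =>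
    rw [List.flatMap_cons, ← FreeGroup.mul_mk, ← FreeGroup.mul_mk, ih, hpow]
    rfl

theorem prod_conj (t b : Q) (h : ℕ → Q) (n : ℕ) :
    ((List.range n).map fun k => t⁻¹ * h k * t * b).prod =
      t⁻¹ * ((List.range n).map fun k => h k * (t * b * t⁻¹)).prod * t := by
  induction n with
  | zero => simp
  | succ n ih =>
    rw [List.range_succ, List.map_append, List.prod_append, ih]
    simp [mul_assoc]

theorem prod_ite (x x' c : Q) (n : ℕ) :
    ((List.range (n + 1)).map fun k => (if k = 0 then x'⁻¹ * x else x ^ (k + 1)) * c).prod =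
      x'⁻¹ * ((List.range (n + 1)).map fun k => x ^ (k + 1) * c).prod := by
  simp [List.range_succ_eq_map, Function.comp_def, mul_assoc]

theorem prod_map_syl_eq_one_iff (F : M →* Q) (v : Vtx) (s : Option ℤ) :
    ((List.range 100).map fun k => F (syl v s k)).prod = 1 ↔
      ((List.range 100).map fun k => F (FreeGroup.of (.vert v)) ^ (k + 1) *
        F (FreeGroup.of .t ^ shift s * FreeGroup.of (lastLtr s) *
          (FreeGroup.of .t ^ shift s)⁻¹)).prod = F (FreeGroup.of (.vert (next v s))) := by
  have h (k) : F (syl v s k) = (F (FreeGroup.of .t ^ shift s))⁻¹ *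
      (if k = 0 then (F (FreeGroup.of (.vert (next v s))))⁻¹ * F (FreeGroup.of (.vert v))
        else F (FreeGroup.of (.vert v)) ^ (k + 1)) * F (FreeGroup.of .t ^ shift s) *
      F (FreeGroup.of (lastLtr s)) := by
    rw [syl, body]
    split_ifs <;> simp
  simp only [h]
  rw [prod_conj, prod_ite]
  simp only [map_mul, map_inv]
  rw [mul_assoc, inv_mul_eq_one, eq_comm, mul_eq_right, inv_mul_eq_one, eq_comm]

/-- The generator of `G` attached to an edge label. -/
def labelGen : Option ℤ → GGen
  | none => some .a
  | some i => some (.b i)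

/-- The generator of `G` attached to a vertex. -/
def vertGen (v : Vtx) : GGen := some (.vert v.1 v.2)

theorem forall_GRels_iff (F : FreeGroup GGen →* Q) : (∀ x ∈ GRels, F x = 1) ↔
    (∀ v s, ((List.range 100).map fun k => F (FreeGroup.of (vertGen v)) ^ (k + 1) *
        F (FreeGroup.of (labelGen s))).prod = F (FreeGroup.of (vertGen (next v s)))) ∧
    ∀ i : ℤ, F (FreeGroup.of none) * F (FreeGroup.of (labelGen (some i))) *
      (F (FreeGroup.of none))⁻¹ = F (FreeGroup.of (labelGen (some (i + 1)))) := by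
  have hu {α : Type} (x y z : α) : FreeGroup.mk (uWord x y ++ [(z, false)]) =
      ((List.range 100).map fun k => FreeGroup.of x ^ (k + 1) * FreeGroup.of y).prod *
        (FreeGroup.of z)⁻¹ := by
    have : FreeGroup.mk [(z, false)] = (FreeGroup.of z)⁻¹ := rfl
    rw [← FreeGroup.mul_mk, mk_uWord, this]
  have hmap (x y z : KGen) : (uWord x y ++ [(z, false)]).map
      (fun p => ((some p.1 : GGen), p.2)) = uWord (some x) (some y) ++ [(some z, false)] := by
    simp [uWord, List.map_flatMap]
  have hF (x y z : GGen) : F (FreeGroup.mk (uWord x y ++ [(z, false)])) = 1 ↔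
      ((List.range 100).map fun k => F (FreeGroup.of x) ^ (k + 1) * F (FreeGroup.of y)).prod =
        F (FreeGroup.of z) := by
    rw [hu, map_mul, map_inv, mul_inv_eq_one, map_list_prod, List.map_map]
    simp [Function.comp_def]
  have hF2 (x y z : GGen) : F (FreeGroup.mk [(x, true), (y, true), (x, false), (z, false)]) = 1 ↔
      F (FreeGroup.of x) * F (FreeGroup.of y) * (F (FreeGroup.of x))⁻¹ = F (FreeGroup.of z) := by
    have : FreeGroup.mk [(x, true), (y, true), (x, false), (z, false)] =
      FreeGroup.of x * FreeGroup.of y * (FreeGroup.of x)⁻¹ * (FreeGroup.of z)⁻¹ := rfl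
    rw [this, map_mul, map_inv, mul_inv_eq_one, map_mul, map_mul, map_inv]
  constructor
  · intro h
    refine ⟨fun v s => (hF _ _ _).1 (h _ ?_), fun i => (hF2 _ _ _).1 (h _ ⟨_, .inr ⟨i, rfl⟩, rfl⟩)⟩
    rcases s with _ | i
    · exact ⟨_, .inl ⟨_, .inl ⟨v.1, v.2, rfl⟩, hmap _ _ _⟩, rfl⟩
    · exact ⟨_, .inl ⟨_, .inr ⟨v.1, v.2, i, rfl⟩, hmap _ _ _⟩, rfl⟩
  · rintro ⟨h1, h2⟩ _ ⟨_, ⟨_, ⟨n, τ, rfl⟩ | ⟨n, τ, i, rfl⟩, rfl⟩ | ⟨i, rfl⟩, rfl⟩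
    · simp only [hmap]
      exact (hF _ _ _).2 (h1 (n, τ) none)
    · simp only [hmap]
      exact (hF _ _ _).2 (h1 (n, τ) (some i))
    · exact (hF2 _ _ _).2 (h2 i)

end Relators

/-- The elements of `G` attached to the letters. -/
def ltrG : Ltr → G
  | .vert v => gvert v.1 v.2
  | .t => gt'
  | .a => ga
  | .b => gb 0

/-- The canonical homomorphism to `G`. -/
def toG : M →* G := FreeGroup.lift ltrG

theorem gb_eq (i : ℤ) : gb i = toG (FreeGroup.of .t ^ i * FreeGroup.of .b * (FreeGroup.of .t ^ i)⁻¹) := by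
  have h (i : ℤ) : gt' * gb i * gt'⁻¹ = gb (i + 1) :=
    ((forall_GRels_iff (PresentedGroup.mk GRels)).1
      fun x hx => PresentedGroup.one_of_mem hx).2 i
  simp only [map_mul, map_inv, map_zpow, toG, FreeGroup.lift_apply_of, ltrG]
  induction i with
  | zero => simp
  | succ i ih =>
    rw [← h, ih, add_comm, zpow_one_add]
    group
  | pred i ih =>
    have h1 := h (-i - 1)
    rw [sub_add_cancel, ih] at h1
    rw [mul_inv_eq_iff_eq_mul, ← eq_inv_mul_iff_mul_eq] at h1
    rw [h1, zpow_sub_one, ((Commute.refl gt').zpow_left _).inv_right.eq]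
    group

theorem prod_toG_syl (v : Vtx) (s : Option ℤ) :
    ((List.range 100).map fun k => toG (syl v s k)).prod = 1 := by
  have h := ((forall_GRels_iff (PresentedGroup.mk GRels)).1
      fun x hx => PresentedGroup.one_of_mem hx).1 v s
  rw [prod_map_syl_eq_one_iff]
  have hs : toG (FreeGroup.of .t ^ shift s * FreeGroup.of (lastLtr s) *
      (FreeGroup.of .t ^ shift s)⁻¹) = PresentedGroup.mk GRels (FreeGroup.of (labelGen s)) := by
    rcases s with _ | i
    · simp [shift, lastLtr, labelGen, toG, ltrG]
      rfl
    · exact (gb_eq i).symm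
  rw [hs]
  exact h

theorem toG_surjective : Function.Surjective toG := by
  rw [← MonoidHom.range_eq_top, eq_top_iff, ← PresentedGroup.closure_range_of, Subgroup.closure_le]
  rintro _ ⟨_ | ⟨n, τ⟩ | _ | i, rfl⟩
  · exact ⟨FreeGroup.of .t, by simp [toG, ltrG, gt']⟩
  · exact ⟨FreeGroup.of (.vert (n, τ)), by simp [toG, ltrG, gvert]⟩
  · exact ⟨FreeGroup.of .a, by simp [toG, ltrG, ga]⟩
  · exact ⟨_, (gb_eq i).symm⟩

/-- A homomorphism from `M` that kills the relators factors through `G`. -/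
theorem exists_hom_comp_toG {Q : Type*} [Group Q] (F : M →* Q)
    (h : ∀ v s, ((List.range 100).map fun k => F (syl v s k)).prod = 1) :
    ∃ f : G →* Q, ∀ m, f (toG m) = F m := by
  let gen : GGen → Q
    | none => F (FreeGroup.of .t)
    | some (.vert n τ) => F (FreeGroup.of (.vert (n, τ)))
    | some .a => F (FreeGroup.of .a)
    | some (.b i) => F (FreeGroup.of .t ^ i * FreeGroup.of .b * (FreeGroup.of .t ^ i)⁻¹)
  have hgen : ∀ r ∈ GRels, FreeGroup.lift gen r = 1 := by
    rw [forall_GRels_iff]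
    simp only [FreeGroup.lift_apply_of]
    refine ⟨fun v s => ?_, fun i => ?_⟩
    · have hs : gen (labelGen s) = F (FreeGroup.of .t ^ shift s * FreeGroup.of (lastLtr s) *
          (FreeGroup.of .t ^ shift s)⁻¹) := by
        cases s <;> simp [gen, labelGen, shift, lastLtr]
      rw [hs]
      exact (prod_map_syl_eq_one_iff F v s).1 (h v s)
    · simp only [gen, labelGen, ← map_mul, ← map_inv]
      congr 1
      rw [add_comm, zpow_one_add]
      group
  refine ⟨PresentedGroup.toGroup hgen, DFunLike.congr_fun
    (f := (PresentedGroup.toGroup hgen).comp toG) (FreeGroup.ext_hom _ _ ?_)⟩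
  rintro (v | _ | _ | _) <;>
    simp [toG, ltrG, gvert, gt', ga, gb, PresentedGroup.toGroup.of, gen]

/-- Reindexing a product over a cycle. -/
theorem prod_rotate_eq_one {Q : Type*} [Group Q] {g : ZMod 100 → Q}
    (h : ((List.range 100).map fun c : ℕ => g c).prod = 1) (κ : ZMod 100) :
    ((List.range 100).map fun k : ℕ => g (κ + k)).prod = 1 := by
  have := List.prod_rotate_eq_one_of_prod_eq_one h κ.val
  convert this using 2
  refine List.ext_getElem (by simp) fun k h1 h2 => ?_
  simp [List.getElem_rotate, add_comm]

theorem prod_range_eq_one_iff {Q : Type*} [Group Q] (g : ℕ → Q) :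
    ((List.range 100).map g).prod = 1 ↔
      ((half true).map g).prod = ((half false).map fun c => (g c)⁻¹).prod := by
  have h : List.range 100 = half true ++ (half false).reverse := by decide
  rw [h, List.map_append, List.prod_append, ← eq_inv_iff_mul_eq_one, List.prod_inv_reverse,
    List.map_reverse, List.map_reverse, List.reverse_reverse, List.map_map]
  rfl

/-- The `κ`-th factor of `W`. -/
def factor (κ : ZMod 100) : M →* W := (incW (κ.val < 50)).comp (inc κ.val)

theorem prod_factor_edgeSyl (f : Edge) :
    ((List.range 100).map fun c : ℕ => factor c (edgeSyl f c)).prod = 1 := by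
  have hv (ε : Bool) : ∀ c ∈ half ε, (decide ((c : ZMod 100).val < 50) = ε) ∧ (c : ZMod 100).val = c := by
    cases ε <;> decide
  have hf (ε : Bool) : ∀ c ∈ half ε, factor c = (incW ε).comp (inc c) := by
    intro c hc
    obtain ⟨h1, h2⟩ := hv ε c hc
    rw [factor, h1, h2]
  rw [prod_range_eq_one_iff]
  have h (ε : Bool) : incW ε (amalg ε (FreeGroup.of f)) = Monoid.PushoutI.base amalg (FreeGroup.of f) :=
    Monoid.PushoutI.of_apply_eq_base amalg ε _
  have h2 := (h true).trans (h false).symm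
  simp only [amalg, FreeGroup.lift_apply_of, block, map_list_prod, List.map_map] at h2
  refine Eq.trans ?_ (h2.trans ?_)
  · refine congrArg List.prod (List.map_congr_left fun c hc => ?_)
    simp [hf true c hc, halfSyl]
  · refine congrArg List.prod (List.map_congr_left fun c hc => ?_)
    simp [hf false c hc, halfSyl]

/-- The amount by which a letter rotates the cyclic coordinate. -/
def deg : Ltr → ZMod 100
  | .vert _ => 0
  | .t => 0
  | _ => 1

/-- The permutation attached to a letter. -/
def ltrPerm (x : Ltr) : Equiv.Perm (W × ZMod 100) where
  toFun q := (factor (q.2 - deg x) (FreeGroup.of x) * q.1, q.2 - deg x)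
  invFun q := ((factor q.2 (FreeGroup.of x))⁻¹ * q.1, q.2 + deg x)
  left_inv q := by simp
  right_inv q := by simp

/-- The action of the free group on `W × ZMod 100`. -/
def act : M →* Equiv.Perm (W × ZMod 100) := FreeGroup.lift ltrPerm

theorem act_of (x : Ltr) (q : W × ZMod 100) : act (FreeGroup.of x) q =
    (factor (q.2 - deg x) (FreeGroup.of x) * q.1, q.2 - deg x) := by
  simp [act, ltrPerm]

/-- The elements acting without rotation. -/
def degZero : Subgroup M where
  carrier := {m | ∀ q, act m q = (factor q.2 m * q.1, q.2)}
  one_mem' := by simp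
  mul_mem' := by
    intro m m' h h' q
    rw [map_mul, Equiv.Perm.mul_apply, h', h, map_mul, mul_assoc]
  inv_mem' := by
    intro m h q
    rw [map_inv, Equiv.Perm.inv_eq_iff_eq, h]
    simp

theorem of_mem_degZero {x : Ltr} (hx : deg x = 0) : FreeGroup.of x ∈ degZero := by
  intro q
  rw [act_of, hx, sub_zero]

theorem act_syl (v : Vtx) (s : Option ℤ) (k : ℕ) (q : W × ZMod 100) :
    act (syl v s k) q = (factor (q.2 - 1) (syl v s k) * q.1, q.2 - 1) := by
  have hv (w : Vtx) : FreeGroup.of (.vert w) ∈ degZero := of_mem_degZero rfl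
  have ht : FreeGroup.of .t ∈ degZero := of_mem_degZero rfl
  have hb : body v s k ∈ degZero := by
    rw [body]
    split_ifs
    · exact mul_mem (inv_mem (hv _)) (hv _)
    · exact pow_mem (hv _) _
  have h : FreeGroup.of .t ^ (-shift s) * body v s k * FreeGroup.of .t ^ shift s ∈ degZero :=
    mul_mem (mul_mem (zpow_mem ht _) hb) (zpow_mem ht _)
  have hd : deg (lastLtr s) = 1 := by cases s <;> rfl
  rw [syl, map_mul, Equiv.Perm.mul_apply, act_of, h _, hd, ← mul_assoc, ← map_mul]

theorem prod_act_syl_apply (v : Vtx) (s : Option ℤ) (n : ℕ) (q : W × ZMod 100) :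
    ((List.range n).map fun k => act (syl v s k)).prod q =
      (((List.range n).map fun k : ℕ => factor (q.2 - n + k) (syl v s k)).prod * q.1, q.2 - n) := by
  induction n generalizing q with
  | zero => simp
  | succ n ih =>
    rw [List.range_succ, List.map_append, List.prod_append, Equiv.Perm.mul_apply]
    have h1 : q.2 - 1 - (n : ZMod 100) = q.2 - ((n + 1 : ℕ) : ZMod 100) := by push_cast; ring
    have h2 : q.2 - ((n + 1 : ℕ) : ZMod 100) + n = q.2 - 1 := by push_cast; ring
    rw [List.map_singleton, List.prod_singleton, act_syl, ih, h1]
    simp only [List.map_append, List.prod_append, List.map_singleton, List.prod_singleton, h2,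
      mul_assoc]

theorem prod_act_syl (v : Vtx) (s : Option ℤ) :
    ((List.range 100).map fun k => act (syl v s k)).prod = 1 := by
  refine Equiv.ext fun q => ?_
  have h100 : ((100 : ℕ) : ZMod 100) = 0 := ZMod.natCast_self 100
  have h := prod_rotate_eq_one (g := fun c => factor c (syl v s (-q.2 + c).val))
    (prod_factor_edgeSyl (v, s, -q.2)) q.2
  rw [prod_act_syl_apply, h100, sub_zero]
  have h2 : ((List.range 100).map fun k : ℕ => factor (q.2 + k) (syl v s k)).prod = 1 := by
    rw [← h]
    refine congrArg List.prod (List.map_congr_left fun k hk => ?_)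
    rw [neg_add_cancel_left, ZMod.val_cast_of_lt (List.mem_range.1 hk)]
  rw [h2, one_mul]
  rfl

/-- The homomorphism to `G` from `P` that is canonical on each factor. -/
def copiesToG : P →* G := Monoid.CoprodI.lift fun _ => toG

theorem copiesToG_amalg (ε : Bool) : copiesToG.comp (amalg ε) = copiesToG.comp (amalg true) := by
  cases ε
  · refine FreeGroup.ext_hom _ _ fun f => ?_
    have h := prod_rotate_eq_one (g := fun c => toG (syl f.1 f.2.1 c.val)) (by
      rw [← prod_toG_syl f.1 f.2.1]
      refine congrArg List.prod (List.map_congr_left fun k hk => ?_)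
      rw [ZMod.val_cast_of_lt (List.mem_range.1 hk)]) f.2.2
    replace h := (prod_range_eq_one_iff fun c => toG (edgeSyl f c)).1 h
    simp only [amalg, MonoidHom.comp_apply, FreeGroup.lift_apply_of, block, map_list_prod,
      List.map_map, Function.comp_def, copiesToG, Monoid.CoprodI.lift_of, halfSyl, cond_true,
      cond_false, map_inv]
    exact h.symm
  · rfl

/-- The map from `W` to `G` that is canonical on each factor. -/
def wToG : W →* G :=
  Monoid.PushoutI.lift (fun _ => copiesToG) (copiesToG.comp (amalg true)) copiesToG_amalg

theorem wToG_factor (κ : ZMod 100) (m : M) : wToG (factor κ m) = toG m := by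
  have h : wToG (incW (κ.val < 50) (inc κ.val m)) = copiesToG (inc κ.val m) :=
    Monoid.PushoutI.lift_of _ _ _ _
  exact h.trans (Monoid.CoprodI.lift_of ..)

theorem foldW_factor (j : ℤ) (κ : ZMod 100) (m : M) :
    foldW j (factor κ m) = factor κ (FreeGroup.map (foldLtr j) m) := by
  simp only [factor, MonoidHom.comp_apply]
  rw [foldW_incW, copiesMap_inc]

/-- A map that is equivariant for the generators of a free group is equivariant. -/
theorem map_perm_eq_of_forall_of {α X Y : Type*} {F : FreeGroup α →* Equiv.Perm X}
    {F' : FreeGroup α →* Equiv.Perm Y} {R : X → Y}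
    (h : ∀ a x, R (F (FreeGroup.of a) x) = F' (FreeGroup.of a) (R x)) (m : FreeGroup α) (x : X) :
    R (F m x) = F' m (R x) := by
  induction m using FreeGroup.induction_on generalizing x with
  | C1 => simp
  | of a => exact h a x
  | inv_of a _ =>
    rw [map_inv, map_inv, Equiv.Perm.eq_inv_iff_eq, ← h]
    simp
  | mul m m' h1 h2 => rw [map_mul, map_mul, Equiv.Perm.mul_apply, Equiv.Perm.mul_apply, h1, h2]

theorem wToG_act (m : M) (q : W × ZMod 100) : wToG (act m q).1 = toG m * wToG q.1 := by
  refine map_perm_eq_of_forall_of (F' := (MulAction.toPermHom G G).comp toG)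
    (R := fun q : W × ZMod 100 => wToG q.1) ?_ m q
  intro x q
  simp [act_of, wToG_factor]

theorem foldW_act (j : ℤ) (m : M) (q : W × ZMod 100) :
    (foldW j (act m q).1, (act m q).2) =
      act (FreeGroup.map (foldLtr j) m) (foldW j q.1, q.2) := by
  refine map_perm_eq_of_forall_of (F' := act.comp (FreeGroup.map (foldLtr j)))
    (R := fun q : W × ZMod 100 => (foldW j q.1, q.2)) ?_ m q
  intro x q
  have hd : deg (foldLtr j x) = deg x := by cases x <;> rfl
  simp [act_of, foldW_factor, hd]

theorem exists_foldG (j : ℤ) :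
    ∃ f : G →* G, ∀ m, f (toG m) = toG (FreeGroup.map (foldLtr j) m) :=
  exists_hom_comp_toG (toG.comp (FreeGroup.map (foldLtr j))) fun v s => by
    simp only [MonoidHom.comp_apply, map_foldLtr_syl, prod_toG_syl]

/-- The endomorphism of `G` induced by `fold j`. -/
noncomputable def foldG (j : ℤ) : G →* G := (exists_foldG j).choose

theorem foldG_toG (j : ℤ) (m : M) : foldG j (toG m) = toG (FreeGroup.map (foldLtr j) m) :=
  (exists_foldG j).choose_spec m

theorem eventually_foldG_ne_one {x : G} (hx : x ≠ 1) :
    ∀ᶠ j in Filter.cofinite, foldG j x ≠ 1 := by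
  obtain ⟨m, rfl⟩ := toG_surjective x
  obtain ⟨Λ, hΛ⟩ := exists_hom_comp_toG act prod_act_syl
  have hw : (act m (1, 0)).1 ≠ 1 := by
    intro h
    have := wToG_act m (1, 0)
    rw [h, map_one, mul_one] at this
    exact hx this.symm
  filter_upwards [eventually_foldW_ne_one hw] with j hj h
  rw [foldG_toG] at h
  have h1 := hΛ (FreeGroup.map (foldLtr j) m)
  rw [h, map_one] at h1
  have h2 := foldW_act j m (1, 0)
  rw [← h1, map_one] at h2
  exact hj (congrArg Prod.fst h2)

theorem foldG_comp {ι : G →* G} (hvert : ∀ (n : ℕ) (τ : List ℤ), ι (gvert n τ) = gvert (n + 1) τ)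
    (ha : ι ga = ga) (hb : ι (gb 0) = gb 0) (ht : ι gt' = gt') (j : ℤ) :
    (foldG j).comp ι = MonoidHom.id G := by
  rw [← MonoidHom.cancel_right toG_surjective]
  refine FreeGroup.ext_hom _ _ fun x => ?_
  have h (y : Ltr) : foldG j (ltrG y) = ltrG (foldLtr j y) := by
    simpa [toG] using foldG_toG j (FreeGroup.of y)
  simp only [MonoidHom.comp_apply, toG, FreeGroup.lift_apply_of, MonoidHom.id_apply]
  rcases x with ⟨n, τ⟩ | _ | _ | _
  · simp only [ltrG, hvert]
    exact h (.vert (n + 1, τ))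
  · simp only [ltrG, ht]
    exact h .t
  · simp only [ltrG, ha]
    exact h .a
  · simp only [ltrG, hb]
    exact h .b

theorem eventually_mapDomain_foldG_ne_zero {R : Type*} [Semiring R] {s : MonoidAlgebra R G}
    (hs : s ≠ 0) : ∀ᶠ j in Filter.cofinite, MonoidAlgebra.mapDomainRingHom R (foldG j) s ≠ 0 := by
  have h : ∀ x y : G, x ≠ y → ∀ᶠ j in Filter.cofinite, foldG j x ≠ foldG j y := by
    intro x y hxy
    filter_upwards [eventually_foldG_ne_one (div_ne_one.2 hxy)] with j hj h
    exact hj (by rw [map_div, h, div_self'])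
  filter_upwards [eventually_injOn_of_finite h s.coeff.support.finite_toSet] with j hj h0
  have h1 : Finsupp.mapDomain (foldG j) s.coeff = Finsupp.mapDomain (foldG j) 0 := by
    rw [Finsupp.mapDomain_zero]
    exact congrArg MonoidAlgebra.coeff h0
  have h2 := Finsupp.mapDomain_injOn _ hj (by simp) (by simp) h1
  exact hs (MonoidAlgebra.coeff_injective h2)

end TreeGroup

/-- For the injective endomorphism `ι* : R[G] → R[G]` induced by `ι` with image `B`, and any
finite `T ⊆ R[G]` with `0 ∉ T`, there is a ring endomorphism `β` of `R[G]` fixing `B`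
pointwise, with image `B`, and with `0 ∉ β(T)`. -/
theorem stmt15 {R : Type*} [Ring R] [Nontrivial R]
    (ι : G →* G) (hinj : Function.Injective ι)
    (hvert : ∀ (n : ℕ) (τ : List ℤ), ι (gvert n τ) = gvert (n + 1) τ)
    (ha : ι ga = ga) (hb : ∀ i : ℤ, ι (gb i) = gb i) (ht : ι gt' = gt')
    (T : Finset (MonoidAlgebra R G)) (hT : (0 : MonoidAlgebra R G) ∉ T) :
    ∃ β : MonoidAlgebra R G →+* MonoidAlgebra R G,
      (∀ x ∈ (MonoidAlgebra.mapDomainRingHom R ι).range, β x = x) ∧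
      β.range = (MonoidAlgebra.mapDomainRingHom R ι).range ∧
      ∀ s ∈ T, β s ≠ 0 := by
  have hinj' : Function.Injective (MonoidAlgebra.mapDomainRingHom R ι) :=
    MonoidAlgebra.mapDomain_injective hinj
  have hcomp (j : ℤ) (x : MonoidAlgebra R G) : MonoidAlgebra.mapDomainRingHom R (TreeGroup.foldG j)
      (MonoidAlgebra.mapDomainRingHom R ι x) = x := by
    rw [← RingHom.comp_apply, ← MonoidAlgebra.mapDomainRingHom_comp,
      TreeGroup.foldG_comp hvert ha (hb 0) ht j]
    simp
  have hT' : ∀ᶠ j in Filter.cofinite, ∀ s ∈ T,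
      MonoidAlgebra.mapDomainRingHom R (TreeGroup.foldG j) s ≠ 0 :=
    (Filter.eventually_all_finset T).2 fun s hs =>
      TreeGroup.eventually_mapDomain_foldG_ne_zero fun h => hT (h ▸ hs)
  obtain ⟨j, hj⟩ := hT'.exists
  refine ⟨(MonoidAlgebra.mapDomainRingHom R ι).comp (MonoidAlgebra.mapDomainRingHom R (TreeGroup.foldG j)),
    ?_, le_antisymm ?_ ?_, fun s hs => ?_⟩
  · rintro _ ⟨x, rfl⟩
    rw [RingHom.comp_apply, hcomp]
  · rintro _ ⟨x, rfl⟩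
    exact ⟨_, rfl⟩
  · rintro _ ⟨x, rfl⟩
    exact ⟨MonoidAlgebra.mapDomainRingHom R ι x, by rw [RingHom.comp_apply, hcomp]⟩
  · rw [RingHom.comp_apply]
    exact (map_ne_zero_iff _ hinj').2 (hj s hs)
end
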